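/- The order of the Mathieu group M₂₄ equals 2^10 · 3^3 · 5 · 7 · 11 · 23 = 244823040. -/

import Mathlib

/-- A subgroup `G ≤ Sym(Fin n)` is `k`-transitive if it acts transitively on
ordered `k`-tuples of distinct points. -/
def IsKTransitive {n : ℕ} (G : Subgroup (Equiv.Perm (Fin n))) (k : ℕ) : Prop :=
  ∀ x y : Fin k ↪ Fin n, ∃ g ∈ G, ∀ i, g (x i) = y i

namespace Equiv.Perm

open MulAction Subgroup

set_option linter.unusedSectionVars false
set_option linter.unusedDecidableInType false
set_option linter.unusedFintypeInType false

section Tools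

variable {α : Type*} [Fintype α] [DecidableEq α]

/-- The subgroup of the elements of `G` fixing every point of `s`. -/
def pointFixer (G : Subgroup (Perm α)) (s : Finset α) : Subgroup (Perm α) where
  carrier := {g | g ∈ G ∧ ∀ a ∈ s, g a = a}
  mul_mem' := fun hg hh => ⟨G.mul_mem hg.1 hh.1, fun a ha => by
    rw [mul_apply, hh.2 a ha, hg.2 a ha]⟩
  one_mem' := ⟨G.one_mem, fun _ _ => rfl⟩
  inv_mem' := fun hg => ⟨G.inv_mem hg.1, fun a ha => by
    rw [inv_eq_iff_eq, hg.2 a ha]⟩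

theorem mem_pointFixer {G : Subgroup (Perm α)} {s : Finset α} {g : Perm α} :
    g ∈ pointFixer G s ↔ g ∈ G ∧ ∀ a ∈ s, g a = a := Iff.rfl

theorem pointFixer_le (G : Subgroup (Perm α)) (s : Finset α) : pointFixer G s ≤ G :=
  fun _ hg => hg.1

open scoped Classical in
/-- The set of common fixed points of the elements of `P`. -/
noncomputable def fixedPts (P : Subgroup (Perm α)) : Finset α :=
  Finset.univ.filter fun a => ∀ g ∈ P, g a = a

theorem mem_fixedPts {P : Subgroup (Perm α)} {a : α} :
    a ∈ fixedPts P ↔ ∀ g ∈ P, g a = a := by simp [fixedPts]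

open scoped Classical in
/-- The orbit of `a` under `P`, as a finset. -/
noncomputable def orb (P : Subgroup (Perm α)) (a : α) : Finset α :=
  Finset.univ.filter fun b => ∃ g ∈ P, g a = b

theorem mem_orb {P : Subgroup (Perm α)} {a b : α} :
    b ∈ orb P a ↔ ∃ g ∈ P, g a = b := by simp [orb]

theorem self_mem_orb (P : Subgroup (Perm α)) (a : α) : a ∈ orb P a :=
  mem_orb.2 ⟨1, P.one_mem, rfl⟩

theorem apply_mem_orb {P : Subgroup (Perm α)} {a b : α} {g : Perm α} (hg : g ∈ P)
    (hb : b ∈ orb P a) : g b ∈ orb P a := by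
  obtain ⟨k, hk, rfl⟩ := mem_orb.1 hb
  exact mem_orb.2 ⟨g * k, P.mul_mem hg hk, rfl⟩

theorem orb_subset {P : Subgroup (Perm α)} {A : Finset α} (hA : ∀ g ∈ P, ∀ a ∈ A, g a ∈ A)
    {a : α} (ha : a ∈ A) : orb P a ⊆ A := by
  intro b hb
  obtain ⟨g, hg, rfl⟩ := mem_orb.1 hb
  exact hA g hg a ha

theorem coe_orb (P : Subgroup (Perm α)) (a : α) :
    (orb P a : Set α) = MulAction.orbit P a := by
  ext b
  simp only [Finset.mem_coe, mem_orb, MulAction.mem_orbit_iff, Subtype.exists, Subgroup.mk_smul,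
    Perm.smul_def, exists_prop]

theorem card_orb (P : Subgroup (Perm α)) (a : α) :
    (orb P a).card = Nat.card (MulAction.orbit P a) := by
  rw [← coe_orb, Nat.card_coe_set_eq, Set.ncard_coe_finset]

theorem card_orb_mul (P : Subgroup (Perm α)) (a : α) :
    (orb P a).card * Nat.card (pointFixer P {a}) = Nat.card P := by
  have e : pointFixer P {a} = (MulAction.stabilizer P a).map P.subtype := by
    ext g
    simp [mem_pointFixer, Subgroup.mem_map, MulAction.mem_stabilizer_iff, Subgroup.smul_def, and_comm]
  rw [e, Nat.card_congr (Subgroup.equivMapOfInjective _ _ P.subtype_injective).symm.toEquiv,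
    card_orb, ← Nat.card_prod]
  exact Nat.card_congr (MulAction.orbitProdStabilizerEquivGroup P a)

theorem card_orb_pgroup {p : ℕ} [Fact p.Prime] {P : Subgroup (Perm α)} (hP : IsPGroup p P) (a : α) :
    ∃ n, (orb P a).card = p ^ n := by
  rw [card_orb]; exact hP.card_orbit a

/-- A `p`-group acting on a finite set fixes, modulo `p`, as many points as there are. -/
theorem card_modEq_inter_fixedPts {p : ℕ} [Fact p.Prime] {P : Subgroup (Perm α)}
    (hP : IsPGroup p P) {A : Finset α} (hA : ∀ g ∈ P, ∀ a ∈ A, g a ∈ A) :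
    A.card ≡ (A ∩ fixedPts P).card [MOD p] := by
  let X : SubMulAction P α := ⟨(A : Set α), fun c {x} hx => hA c.1 c.2 x hx⟩
  have h := hP.card_modEq_card_fixedPoints X
  have h1 : Nat.card X = A.card := by
    change Nat.card (A : Set α) = _
    rw [Nat.card_coe_set_eq, Set.ncard_coe_finset]
  have h2 : Nat.card (MulAction.fixedPoints P X) = (A ∩ fixedPts P).card := by
    rw [← Set.ncard_coe_finset, ← Nat.card_coe_set_eq]
    refine Nat.card_congr ⟨fun x => ⟨x.1.1, ?_⟩, fun x => ⟨⟨x.1, ?_⟩, ?_⟩, ?_, ?_⟩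
    · have := x.2
      simp only [Finset.coe_inter, Set.mem_inter_iff, Finset.mem_coe, mem_fixedPts]
      exact ⟨x.1.2, fun g hg => congrArg Subtype.val (this ⟨g, hg⟩)⟩
    · have := x.2
      simp only [Finset.coe_inter, Set.mem_inter_iff, Finset.mem_coe] at this
      exact this.1
    · have := x.2
      simp only [Finset.coe_inter, Set.mem_inter_iff, Finset.mem_coe, mem_fixedPts] at this
      exact fun g => Subtype.ext (this.2 g.1 g.2)
    · intro x; rfl
    · intro x; rfl
  rwa [h1, h2] at h

theorem isPGroup_zpowers {G : Type*} [Group G] {p : ℕ} {z : G} (hz : orderOf z = p) :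
    IsPGroup p (zpowers z) :=
  IsPGroup.of_card (n := 1) (by rw [Nat.card_zpowers, hz, pow_one])

theorem mem_fixedPts_zpowers {z : Perm α} {a : α} : a ∈ fixedPts (zpowers z) ↔ z a = a := by
  rw [mem_fixedPts]
  constructor
  · intro h; exact h z (mem_zpowers z)
  · rintro h g ⟨n, rfl⟩
    exact zpow_apply_eq_self_of_apply_eq_self h n

theorem zpow_mem_of_invariant {z : Perm α} {A : Finset α} (hA : ∀ a ∈ A, z a ∈ A)
    {g : Perm α} (hg : g ∈ zpowers z) : ∀ a ∈ A, g a ∈ A := by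
  obtain ⟨n, -, hn⟩ := Finset.mem_image.1 (mem_zpowers_iff_mem_range_orderOf.1 hg)
  intro a ha
  rw [← hn]
  clear hn
  induction n with
  | zero => simpa
  | succ n ih => rw [pow_succ']; exact hA _ ih

theorem card_modEq_sdiff_support {p : ℕ} [Fact p.Prime] {z : Perm α} (hz : orderOf z = p)
    {A : Finset α} (hA : ∀ a ∈ A, z a ∈ A) : A.card ≡ (A \ z.support).card [MOD p] := by
  have h := card_modEq_inter_fixedPts (isPGroup_zpowers hz)
    (fun g hg => zpow_mem_of_invariant hA hg)
  have e : A ∩ fixedPts (zpowers z) = A \ z.support := by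
    ext a; simp [mem_fixedPts_zpowers]
  rwa [e] at h

/-- The elements of a `z`-invariant set of permutations commuting with `z`, counted modulo the
order of `z`. -/
theorem card_modEq_commute {p : ℕ} [Fact p.Prime] {z : Perm α} (hz : z ^ p = 1)
    (T : Finset (Perm α)) (hT : ∀ g ∈ T, z * g * z⁻¹ ∈ T) :
    T.card ≡ (T.filter fun g => z * g = g * z).card [MOD p] := by
  let φ : Perm (Perm α) := (MulAut.conj z).toEquiv
  have hφ : φ ^ p = 1 := by
    have : φ = MulAut.toPerm (Perm α) (MulAut.conj z) := rfl
    rw [this, ← map_pow, ← map_pow, hz, map_one, map_one]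
  have hP : IsPGroup p (zpowers φ) := by
    rcases (Nat.dvd_prime (Fact.out : p.Prime)).1 (orderOf_dvd_of_pow_eq_one hφ) with h | h
    · exact IsPGroup.of_card (n := 0) (by rw [Nat.card_zpowers, h, pow_zero])
    · exact isPGroup_zpowers h
  have h := card_modEq_inter_fixedPts hP (A := T)
    (fun g hg => zpow_mem_of_invariant (fun a ha => hT a ha) hg)
  have e : T ∩ fixedPts (zpowers φ) = T.filter fun g => z * g = g * z := by
    ext a
    rw [Finset.mem_inter, mem_fixedPts_zpowers, Finset.mem_filter]
    have : φ a = z * a * z⁻¹ := rfl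
    rw [this, mul_inv_eq_iff_eq_mul]
  rwa [e] at h

theorem exists_commute_of_not_dvd {p : ℕ} [Fact p.Prime] {z : Perm α} (hz : z ^ p = 1)
    (T : Finset (Perm α)) (hT : ∀ g ∈ T, z * g * z⁻¹ ∈ T) (hp : ¬ p ∣ T.card) :
    ∃ g ∈ T, z * g = g * z := by
  by_contra! h
  have := card_modEq_commute hz T hT
  rw [Finset.filter_eq_empty_iff.2 (fun g hg => h g hg), Finset.card_empty] at this
  exact hp (Nat.modEq_zero_iff_dvd.1 this)

theorem conj_mem_of_mem_normalizer {P : Subgroup (Perm α)} {z g : Perm α}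
    (hz : z ∈ normalizer (P : Set (Perm α))) (hg : g ∈ P) : z * g * z⁻¹ ∈ P :=
  (mem_normalizer_iff.1 hz g).1 hg

theorem apply_mem_fixedPts {P : Subgroup (Perm α)} {z : Perm α}
    (hz : z ∈ normalizer (P : Set (Perm α))) {a : α} (ha : a ∈ fixedPts P) :
    z a ∈ fixedPts P := by
  rw [mem_fixedPts] at *
  intro g hg
  have := ha _ (conj_mem_of_mem_normalizer (inv_mem hz) hg)
  rw [inv_inv, mul_apply, mul_apply, inv_eq_iff_eq] at this
  exact this

theorem apply_mem_compl_of_invariant {z : Perm α} {A : Finset α} (hA : ∀ a ∈ A, z a ∈ A) :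
    ∀ a ∈ Aᶜ, z a ∈ Aᶜ := by
  intro a ha
  rw [Finset.mem_compl] at *
  intro h
  apply ha
  have := zpow_mem_of_invariant hA (inv_mem (mem_zpowers z)) _ h
  simpa using this

theorem apply_mem_orb_of_normalizer {P : Subgroup (Perm α)} {z : Perm α}
    (hz : z ∈ normalizer (P : Set (Perm α))) {a : α} (ha : z a = a) :
    ∀ b ∈ orb P a, z b ∈ orb P a := by
  intro b hb
  obtain ⟨g, hg, rfl⟩ := mem_orb.1 hb
  refine mem_orb.2 ⟨_, conj_mem_of_mem_normalizer hz hg, ?_⟩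
  rw [mul_apply, mul_apply, inv_eq_iff_eq.2 ha.symm]

theorem orb_card_ne_one {P : Subgroup (Perm α)} {a : α} (ha : a ∉ fixedPts P) :
    (orb P a).card ≠ 1 := by
  intro h
  apply ha
  rw [mem_fixedPts]
  intro g hg
  exact Finset.card_le_one.1 h.le _ (mem_orb.2 ⟨g, hg, rfl⟩) _ (self_mem_orb P a)

/-- `M` moves any `k`-tuple of distinct points of `s` to any other one. -/
def KTransOn (M : Subgroup (Perm α)) (s : Finset α) (k : ℕ) : Prop :=
  ∀ x y : Fin k ↪ α, (∀ i, x i ∈ s) → (∀ i, y i ∈ s) → ∃ g ∈ M, ∀ i, g (x i) = y i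

theorem KTransOn.descFactorial_dvd {M : Subgroup (Perm α)} {s : Finset α} {k : ℕ}
    (h : KTransOn M s k) (hM : ∀ g ∈ M, ∀ a ∈ s, g a ∈ s) (hk : k ≤ s.card) :
    s.card.descFactorial k ∣ Nat.card M := by
  classical
  obtain ⟨t, hts, htk⟩ := Finset.exists_subset_card_eq hk
  let x : Fin k ↪ α := (t.equivFinOfCardEq htk).symm.toEmbedding.trans (Function.Embedding.subtype _)
  have hx : ∀ i, x i ∈ s := fun i => hts ((t.equivFinOfCardEq htk).symm i).2
  have e : Nat.card (MulAction.orbit M x) = s.card.descFactorial k := by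
    have : Nat.card (Fin k ↪ s) = s.card.descFactorial k := by
      rw [Nat.card_eq_fintype_card, Fintype.card_embedding_eq, Fintype.card_coe, Fintype.card_fin]
    rw [← this]
    refine Nat.card_congr ⟨fun y => ⟨fun i => ⟨y.1 i, ?_⟩, ?_⟩,
      fun y => ⟨y.trans (Function.Embedding.subtype _), ?_⟩, ?_, ?_⟩
    · obtain ⟨g, hg⟩ := y.2
      rw [← hg]
      exact hM g.1 g.2 _ (hx i)
    · intro i j hij
      exact y.1.injective (congrArg Subtype.val hij)
    · obtain ⟨g, hg, hgx⟩ := h x (y.trans (Function.Embedding.subtype _)) hx (fun i => (y i).2)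
      exact ⟨⟨g, hg⟩, Function.Embedding.ext hgx⟩
    · intro y; rfl
    · intro y; rfl
  rw [← e, ← Nat.card_congr (MulAction.orbitProdStabilizerEquivGroup M x), Nat.card_prod]
  exact Dvd.intro _ rfl

/-- Orbit-stabilizer for tuples. -/
theorem KTransOn.card_eq {M : Subgroup (Perm α)} {k : ℕ}
    (h : KTransOn M Finset.univ k) {s : Finset α} (hs : s.card = k) :
    Nat.card M = (Fintype.card α).descFactorial k * Nat.card (pointFixer M s) := by
  classical
  let x : Fin k ↪ α := (s.equivFinOfCardEq hs).symm.toEmbedding.trans (Function.Embedding.subtype _)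
  have hx : ∀ a, a ∈ s ↔ ∃ i, x i = a := by
    intro a
    constructor
    · intro ha
      exact ⟨s.equivFinOfCardEq hs ⟨a, ha⟩, by simp [x]⟩
    · rintro ⟨i, rfl⟩
      exact ((s.equivFinOfCardEq hs).symm i).2
  have e : MulAction.orbit M x = _root_.Set.univ := by
    ext y
    simp only [Set.mem_univ, iff_true]
    obtain ⟨g, hg, hgx⟩ := h x y (by simp) (by simp)
    exact ⟨⟨g, hg⟩, Function.Embedding.ext hgx⟩
  have e2 : pointFixer M s = (MulAction.stabilizer M x).map M.subtype := by
    ext g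
    simp only [mem_pointFixer, Subgroup.mem_map, MulAction.mem_stabilizer_iff, hx,
      Function.Embedding.ext_iff, Subtype.exists, subtype_apply]
    constructor
    · rintro ⟨h1, h2⟩
      exact ⟨g, h1, fun i => h2 _ ⟨i, rfl⟩, rfl⟩
    · rintro ⟨g, h1, h2, rfl⟩
      refine ⟨h1, ?_⟩
      rintro a ⟨i, rfl⟩
      exact h2 i
  have e3 : Nat.card (MulAction.orbit M x) = (Fintype.card α).descFactorial k := by
    rw [e]
    simp [Nat.card_eq_fintype_card, Fintype.card_embedding_eq]
  rw [e2, Nat.card_congr (Subgroup.equivMapOfInjective _ _ M.subtype_injective).symm.toEquiv,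
    ← e3, ← Nat.card_congr (MulAction.orbitProdStabilizerEquivGroup M x), Nat.card_prod]
  rfl

/-- Existence of Sylow subgroups, together with the conjugacy theorem. -/
theorem exists_sylow (H : Subgroup (Perm α)) (p : ℕ) [Fact p.Prime] :
    ∃ P ≤ H, IsPGroup p P ∧ (∃ m, Nat.card H = Nat.card P * m ∧ ¬ p ∣ m) ∧
      ∀ Q ≤ H, IsPGroup p Q → ∃ h ∈ H, ∀ q ∈ Q, h * q * h⁻¹ ∈ P := by
  classical
  obtain ⟨P⟩ : Nonempty (Sylow p H) := inferInstance
  refine ⟨P.1.map H.subtype, ?_, P.2.map _, ⟨(P : Subgroup H).index, ?_, P.not_dvd_index⟩, ?_⟩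
  · rintro _ ⟨g, -, rfl⟩
    exact g.2
  · rw [Nat.card_congr (Subgroup.equivMapOfInjective _ _ H.subtype_injective).symm.toEquiv]
    exact (Subgroup.card_mul_index _).symm
  · intro Q hQ hQp
    have : IsPGroup p (Q.subgroupOf H) := hQp.of_equiv (Subgroup.subgroupOfEquivOfLe hQ).symm
    obtain ⟨R, hR⟩ := this.exists_le_sylow
    obtain ⟨h, rfl⟩ := MulAction.exists_smul_eq H R P
    refine ⟨h, h.2, fun q hq => ?_⟩
    refine ⟨h * ⟨q, hQ hq⟩ * h⁻¹, ?_, rfl⟩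
    have : (⟨q, hQ hq⟩ : H) ∈ (R : Subgroup H) := hR (by simpa [Subgroup.mem_subgroupOf] using hq)
    exact Subgroup.smul_mem_pointwise_smul _ (MulAut.conj h) _ this

/-- Witt's lemma: if `P` is a Sylow subgroup of the pointwise stabilizer of `k` points of a
`k`-transitive group, its normalizer is `k`-transitive on the fixed points of `P`. -/
theorem KTransOn.witt {G : Subgroup (Perm α)} {k : ℕ} (hG : KTransOn G Finset.univ k)
    {s : Finset α} (hs : s.card = k) {p : ℕ} {P : Subgroup (Perm α)} (hPp : IsPGroup p P)
    (hP : P ≤ pointFixer G s)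
    (hc : ∀ Q ≤ pointFixer G s, IsPGroup p Q → ∃ h ∈ pointFixer G s, ∀ q ∈ Q, h * q * h⁻¹ ∈ P) :
    KTransOn (G ⊓ normalizer (P : Set (Perm α))) (fixedPts P) k := by
  classical
  let x : Fin k ↪ α := (s.equivFinOfCardEq hs).symm.toEmbedding.trans (Function.Embedding.subtype _)
  have hxs : ∀ i, x i ∈ s := fun i => ((s.equivFinOfCardEq hs).symm i).2
  have hsx : ∀ a ∈ s, ∃ i, x i = a :=
    fun a ha => ⟨s.equivFinOfCardEq hs ⟨a, ha⟩, by simp [x]⟩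
  have key : ∀ y : Fin k ↪ α, (∀ i, y i ∈ fixedPts P) →
      ∃ g ∈ G ⊓ normalizer (P : Set (Perm α)), ∀ i, g (y i) = x i := by
    intro y hy
    obtain ⟨g, hg, hgy⟩ := hG y x (by simp) (by simp)
    obtain ⟨h, hh, hhP⟩ := hc (P.map (MulAut.conj g).toMonoidHom) (by
      rintro _ ⟨u, hu, rfl⟩
      refine ⟨G.mul_mem (G.mul_mem hg (hP hu).1) (G.inv_mem hg), ?_⟩
      intro a ha
      obtain ⟨i, rfl⟩ := hsx a ha
      change g (u (g⁻¹ (x i))) = x i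
      rw [← hgy i, show g⁻¹ (g (y i)) = y i by simp, mem_fixedPts.1 (hy i) u hu]) (hPp.map _)
    refine ⟨h * g, ⟨G.mul_mem hh.1 hg, ?_⟩, fun i => ?_⟩
    · have hle : P.map (MulAut.conj (h * g)).toMonoidHom ≤ P := by
        rintro _ ⟨u, hu, rfl⟩
        have := hhP _ ⟨u, hu, rfl⟩
        change h * (g * u * g⁻¹) * h⁻¹ ∈ P at this
        change h * g * u * (h * g)⁻¹ ∈ P
        convert this using 1; group
      have heq : P.map (MulAut.conj (h * g)).toMonoidHom = P :=
        Subgroup.eq_of_le_of_card_ge hle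
          (Nat.card_congr (Subgroup.equivMapOfInjective P _
            (MulAut.conj (h * g)).injective).toEquiv).le
      refine mem_normalizer_iff.2 fun u => ?_
      constructor
      · intro hu
        rw [← heq]; exact ⟨u, hu, rfl⟩
      · intro hu
        rw [← heq] at hu
        obtain ⟨v, hv, hvu⟩ := hu
        have : v = u := (MulAut.conj (h * g)).injective hvu
        rwa [← this]
    · rw [mul_apply, hgy i, hh.2 _ (hxs i)]
  intro y y' hy hy'
  obtain ⟨g, hg, h1⟩ := key y hy
  obtain ⟨g', hg', h2⟩ := key y' hy'
  refine ⟨g'⁻¹ * g, mul_mem (inv_mem hg') hg, fun i => ?_⟩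
  rw [mul_apply, h1, inv_eq_iff_eq, h2]

theorem exists_mem_orderOf_eq {M : Subgroup (Perm α)} {q : ℕ} [Fact q.Prime]
    (h : q ∣ Nat.card M) : ∃ z ∈ M, orderOf z = q := by
  obtain ⟨z, hz⟩ := exists_prime_orderOf_dvd_card' (G := M) q h
  exact ⟨z.1, z.2, by rw [← hz, Subgroup.orderOf_coe]⟩

end Tools

section Jordan

variable {α : Type*} [Fintype α] [DecidableEq α]

theorem KTransOn.isMultiplyPretransitive {G : Subgroup (Perm α)} {k : ℕ}
    (h : KTransOn G Finset.univ k) : IsMultiplyPretransitive G α k := by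
  rw [isMultiplyPretransitive_iff]
  intro x y
  obtain ⟨g, hg, h⟩ := h x y (by simp) (by simp)
  exact ⟨⟨g, hg⟩, Function.Embedding.ext h⟩

theorem ktransOn_of_isMultiplyPretransitive {G : Subgroup (Perm α)} {k : ℕ}
    (h : IsMultiplyPretransitive G α k) : KTransOn G Finset.univ k := by
  rw [isMultiplyPretransitive_iff] at h
  intro x y _ _
  obtain ⟨g, hg⟩ := h x y
  exact ⟨g.1, g.2, fun i => DFunLike.congr_fun hg i⟩

theorem KTransOn.isPreprimitive {G : Subgroup (Perm α)} {k : ℕ}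
    (h : KTransOn G Finset.univ k) (hk : 2 ≤ k) (hα : k ≤ Fintype.card α) :
    IsPreprimitive G α :=
  have := h.isMultiplyPretransitive
  have := isMultiplyPretransitive_of_le (G := G) (α := α) hk
    (by rwa [Nat.card_eq_fintype_card])
  isPreprimitive_of_is_two_pretransitive this

/-- Jordan's theorem for a cycle of prime length. -/
theorem jordan_cycle {G : Subgroup (Perm α)} (hG : IsPreprimitive G α) {z : Perm α} (hz : z ∈ G)
    (hc : z.IsCycle) (hp : z.support.card.Prime) (hlt : z.support.card + 1 < Fintype.card α) {k : ℕ}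
    (hk : k + z.support.card ≤ Fintype.card α + 1) : KTransOn G Finset.univ k := by
  apply ktransOn_of_isMultiplyPretransitive
  have h1 := isPretransitive_of_isCycle_mem hc hz
  set s : Set α := (↑z.support)ᶜ with hs
  have hsc : s.ncard = Fintype.card α - z.support.card := by
    rw [hs, ← Finset.coe_compl, Set.ncard_coe_finset, Finset.card_compl]
  have h2 : Nat.card (SubMulAction.ofFixingSubgroup G s) = z.support.card := by
    change Nat.card (sᶜ : Set α) = _
    rw [hs, compl_compl, Nat.card_coe_set_eq, Set.ncard_coe_finset]
  have h3 : IsPreprimitive (fixingSubgroup G s) (SubMulAction.ofFixingSubgroup G s) :=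
    IsPreprimitive.of_prime_card (h2.symm ▸ hp)
  obtain ⟨n, hn⟩ : ∃ n, Fintype.card α - z.support.card = n + 1 :=
    ⟨Fintype.card α - z.support.card - 1, by omega⟩
  have h4 := hG.isMultiplyPreprimitive (hsc.trans hn)
    (by rw [Nat.card_eq_fintype_card]; have := hp.two_le; omega) h3
  have := h4.isMultiplyPretransitive
  exact isMultiplyPretransitive_of_le (n := n + 2) (by omega)
    (by rw [Nat.card_eq_fintype_card]; have := hp.two_le; omega)

theorem dvd_card_support {p : ℕ} (hp : p.Prime) {z : Perm α} (hz : orderOf z = p) :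
    p ∣ z.support.card := by
  have := Fact.mk hp
  have h := card_modEq_sdiff_support hz (A := z.support) (fun a ha => by simpa using ha)
  rw [Finset.sdiff_self, Finset.card_empty] at h
  exact Nat.modEq_zero_iff_dvd.1 h

theorem le_card_support {p : ℕ} (hp : p.Prime) {z : Perm α} (hz : orderOf z = p) :
    p ≤ z.support.card := by
  refine Nat.le_of_dvd ?_ (dvd_card_support hp hz)
  rw [Finset.card_pos, Finset.nonempty_iff_ne_empty]
  intro h
  rw [support_eq_empty_iff.1 h, orderOf_one] at hz
  exact hp.one_lt.ne hz

/-- A subgroup of prime-power order in `pointFixer G S` which is a Sylow `p`-subgroup, recorded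
through the order and conjugacy statements. -/
structure SylowAt (G : Subgroup (Perm α)) (S : Finset α) (p : ℕ) (P : Subgroup (Perm α)) :
    Prop where
  le : P ≤ pointFixer G S
  pgroup : IsPGroup p P
  index : ∃ m, Nat.card (pointFixer G S) = Nat.card P * m ∧ ¬ p ∣ m
  conj : ∀ Q ≤ pointFixer G S, IsPGroup p Q → ∃ h ∈ pointFixer G S, ∀ q ∈ Q, h * q * h⁻¹ ∈ P

theorem exists_sylowAt (G : Subgroup (Perm α)) (S : Finset α) {p : ℕ} (hp : p.Prime) :
    ∃ P, SylowAt G S p P := by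
  have := Fact.mk hp
  obtain ⟨P, h1, h2, h3, h4⟩ := exists_sylow (pointFixer G S) p
  exact ⟨P, h1, h2, h3, h4⟩

namespace SylowAt

variable {G : Subgroup (Perm α)} {S : Finset α} {p : ℕ} {P : Subgroup (Perm α)}

theorem le_group (h : SylowAt G S p P) : P ≤ G := h.le.trans (pointFixer_le G S)

theorem subset_fixedPts (h : SylowAt G S p P) : S ⊆ fixedPts P := fun a ha =>
  mem_fixedPts.2 fun _ hg => (h.le hg).2 a ha

theorem ktransOn (h : SylowAt G S p P) {k : ℕ} (hG : KTransOn G Finset.univ k) (hS : S.card = k) :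
    KTransOn (G ⊓ normalizer (P : Set (Perm α))) (fixedPts P) k :=
  hG.witt hS h.pgroup h.le h.conj

theorem descFactorial_dvd_card (h : SylowAt G S p P) {k : ℕ} (hG : KTransOn G Finset.univ k)
    (hS : S.card = k) :
    (fixedPts P).card.descFactorial k ∣
      Nat.card (G ⊓ normalizer (P : Set (Perm α)) : Subgroup (Perm α)) :=
  (h.ktransOn hG hS).descFactorial_dvd (fun _ hg _ ha => apply_mem_fixedPts hg.2 ha)
    (hS ▸ Finset.card_le_card h.subset_fixedPts)

theorem descFactorial_dvd_card' (h : SylowAt G S p P) {k : ℕ} (hG : KTransOn G Finset.univ k)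
    (hS : S.card = k) : (fixedPts P).card.descFactorial k ∣ Nat.card G :=
  (h.descFactorial_dvd_card hG hS).trans (Subgroup.card_dvd_of_le inf_le_left)

theorem exists_orderOf_eq (h : SylowAt G S p P) {k : ℕ} (hG : KTransOn G Finset.univ k)
    (hS : S.card = k) {q : ℕ} (hq : q.Prime) (hqd : q ∣ (fixedPts P).card.descFactorial k) :
    ∃ z ∈ G, z ∈ normalizer (P : Set (Perm α)) ∧ orderOf z = q := by
  have := Fact.mk hq
  obtain ⟨z, hz, h⟩ := exists_mem_orderOf_eq (hqd.trans (h.descFactorial_dvd_card hG hS))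
  exact ⟨z, hz.1, hz.2, h⟩

theorem card_modEq (h : SylowAt G S p P) (hp : p.Prime) :
    Fintype.card α ≡ (fixedPts P).card [MOD p] := by
  have := Fact.mk hp
  simpa using card_modEq_inter_fixedPts h.pgroup (A := Finset.univ) (by simp)

theorem card_eq_pow (h : SylowAt G S p P) (hp : p.Prime) : ∃ n, Nat.card P = p ^ n := by
  have := Fact.mk hp
  exact IsPGroup.iff_card.1 h.pgroup

theorem card_lt (h : SylowAt G S p P) (hd : p ∣ Nat.card (pointFixer G S)) :
    (fixedPts P).card < Fintype.card α := by
  refine lt_of_le_of_ne (Finset.card_le_univ _) fun he => ?_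
  have hu := Finset.card_eq_iff_eq_univ _ |>.1 he
  have hb : P = ⊥ := by
    rw [eq_bot_iff]
    intro g hg
    rw [Subgroup.mem_bot]
    ext a
    rw [mem_fixedPts.1 (hu ▸ Finset.mem_univ a) g hg]
    rfl
  obtain ⟨m, hm, hpm⟩ := h.index
  rw [hb, Subgroup.card_bot, one_mul] at hm
  exact hpm (hm ▸ hd)

end SylowAt

end Jordan

/-- `G` is a 5-transitive but not 6-transitive group of permutations of 24 points. -/
structure FiveNotSix (G : Subgroup (Perm (Fin 24))) : Prop where
  five : KTransOn G Finset.univ 5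
  six : ¬ KTransOn G Finset.univ 6

namespace FiveNotSix

variable {G : Subgroup (Perm (Fin 24))} (hG : FiveNotSix G)
include hG

theorem false_of_card_support_lt {z : Perm (Fin 24)} (hz : z ∈ G) {q : ℕ} (hzq : orderOf z = q)
    (hq : q.Prime) (hq19 : q ≤ 19) (hs : z.support.card < 2 * q) : False := by
  subst hzq
  have hc := isCycle_of_prime_order hq hs
  have ho := hc.orderOf
  refine hG.six (jordan_cycle (hG.five.isPreprimitive (by norm_num) (by simp)) hz hc
    (ho ▸ hq) ?_ ?_)
  · rw [← ho, Fintype.card_fin]; omega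
  · rw [← ho, Fintype.card_fin]; omega

theorem card_eq {S : Finset (Fin 24)} (hS : S.card = 5) :
    Nat.card G = 5100480 * Nat.card (pointFixer G S) := by
  rw [hG.five.card_eq hS]; rfl

theorem card_orb_ne {S : Finset (Fin 24)} (hS : S.card = 5) {a : Fin 24} (ha : a ∉ S) :
    (orb (pointFixer G S) a).card ≠ 19 := by
  intro h19
  have hsub : orb (pointFixer G S) a ⊆ Sᶜ := orb_subset (fun g hg b hb => by
    rw [Finset.mem_compl] at *
    intro h
    apply hb
    have := hg.2 _ h
    rwa [g.injective this] at h) (Finset.mem_compl.2 ha)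
  have heq : orb (pointFixer G S) a = Sᶜ := Finset.eq_of_subset_of_card_le hsub (by
    rw [Finset.card_compl, hS, h19]; simp)
  have tr : ∀ b c, b ∉ S → c ∉ S → ∃ g ∈ pointFixer G S, g b = c := by
    intro b c hb hc
    rw [← Finset.mem_compl, ← heq, mem_orb] at hb hc
    obtain ⟨g, hg, rfl⟩ := hb
    obtain ⟨k, hk, rfl⟩ := hc
    exact ⟨k * g⁻¹, mul_mem hk (inv_mem hg), by simp⟩
  apply hG.six
  let s : Fin 5 ↪ Fin 24 :=
    (S.equivFinOfCardEq hS).symm.toEmbedding.trans (Function.Embedding.subtype _)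
  have hs : ∀ b ∈ S, ∃ i, s i = b := fun b hb => ⟨S.equivFinOfCardEq hS ⟨b, hb⟩, by simp [s]⟩
  have hsS : ∀ i, s i ∈ S := fun i => ((S.equivFinOfCardEq hS).symm i).2
  have key : ∀ x : Fin 6 ↪ Fin 24, ∃ g ∈ G, (∀ i : Fin 5, g (x i.castSucc) = s i) ∧
      g (x (Fin.last 5)) ∉ S := by
    intro x
    obtain ⟨g, hg, h⟩ := hG.five (Fin.castSuccEmb.trans x) s (by simp) (by simp)
    refine ⟨g, hg, h, fun hm => ?_⟩
    obtain ⟨i, hi⟩ := hs _ hm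
    rw [← h i] at hi
    have := x.injective (g.injective hi)
    exact (Fin.castSucc_lt_last i).ne this
  intro x y _ _
  obtain ⟨g, hg, hgx, hgl⟩ := key x
  obtain ⟨k, hk, hky, hkl⟩ := key y
  obtain ⟨l, hl, hlg⟩ := tr _ _ hgl hkl
  refine ⟨k⁻¹ * l * g, mul_mem (mul_mem (inv_mem hk) hl.1) hg, fun i => ?_⟩
  rw [mul_apply, mul_apply, inv_eq_iff_eq]
  refine Fin.lastCases ?_ (fun i => ?_) i
  · exact hlg
  · rw [hgx, hky, hl.2 _ (hsS i)]

theorem not_dvd_of_le {S : Finset (Fin 24)} (hS : S.card = 5) {q : ℕ} (hq : q.Prime)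
    (h11 : 11 ≤ q) : ¬ q ∣ Nat.card (pointFixer G S) := by
  intro hd
  have := Fact.mk hq
  obtain ⟨z, hz, hzq⟩ := exists_mem_orderOf_eq hd
  have hsub : z.support ⊆ Sᶜ := fun a ha => by
    rw [Finset.mem_compl]
    intro haS
    exact mem_support.1 ha (hz.2 a haS)
  have h19 := Finset.card_le_card hsub
  rw [Finset.card_compl, hS, Fintype.card_fin] at h19
  have hle := le_card_support hq hzq
  exact hG.false_of_card_support_lt hz.1 hzq hq (by omega) (by omega)

theorem not_dvd_card {q : ℕ} (hq : q.Prime) (h : q = 13 ∨ q = 17 ∨ q = 19) :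
    ¬ q ∣ Nat.card G := by
  obtain ⟨S, -, hS⟩ := Finset.exists_subset_card_eq (s := (Finset.univ : Finset (Fin 24)))
    (n := 5) (by simp)
  rw [hG.card_eq hS, hq.dvd_mul, not_or]
  exact ⟨by rcases h with rfl | rfl | rfl <;> norm_num, hG.not_dvd_of_le hS hq (by omega)⟩

theorem card_fixedPts_ne {S : Finset (Fin 24)} (hS : S.card = 5) {p : ℕ}
    {P : Subgroup (Perm (Fin 24))} (hP : SylowAt G S p P) :
    (fixedPts P).card ∉ ({13, 14, 15, 16, 17, 18, 19, 20, 21, 22, 23} : Finset ℕ) := by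
  intro h
  have hd := hP.descFactorial_dvd_card' hG.five hS
  have h13 := hG.not_dvd_card (q := 13) (by norm_num) (by simp)
  have h17 := hG.not_dvd_card (q := 17) (by norm_num) (by simp)
  have h19 := hG.not_dvd_card (q := 19) (by norm_num) (by simp)
  simp only [Finset.mem_insert, Finset.mem_singleton] at h
  rcases h with h | h | h | h | h | h | h | h | h | h | h <;> rw [h] at hd <;>
  first
  | exact h13 (dvd_trans (by decide) hd)
  | exact h17 (dvd_trans (by decide) hd)
  | exact h19 (dvd_trans (by decide) hd)

theorem not_five_dvd {S : Finset (Fin 24)} (hS : S.card = 5) :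
    ¬ 5 ∣ Nat.card (pointFixer G S) := by
  intro hd
  have h5 : Nat.Prime 5 := by norm_num
  have h7 : Nat.Prime 7 := by norm_num
  have := Fact.mk h5
  have := Fact.mk h7
  obtain ⟨P, hP⟩ := exists_sylowAt G S h5
  have h1 := hP.card_modEq h5
  have h2 := hP.card_lt hd
  have h3 := hG.card_fixedPts_ne hS hP
  have h4 := Finset.card_le_card hP.subset_fixedPts
  simp only [Finset.mem_insert, Finset.mem_singleton, not_or, Nat.ModEq, Fintype.card_fin] at *
  have hf : (fixedPts P).card = 9 := by omega
  obtain ⟨y, hyG, hyP, hy⟩ := hP.exists_orderOf_eq hG.five hS h7 (by rw [hf]; decide)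
  have hinv : ∀ a ∈ (fixedPts P)ᶜ, y a ∈ (fixedPts P)ᶜ :=
    apply_mem_compl_of_invariant fun a ha => apply_mem_fixedPts hyP ha
  have hc := card_modEq_sdiff_support hy hinv
  have hcc : (fixedPts P)ᶜ.card = 15 := by rw [Finset.card_compl, hf]; rfl
  obtain ⟨A, hA⟩ : ∃ A, A = (fixedPts P)ᶜ \ y.support := ⟨_, rfl⟩
  rw [← hA] at hc
  have hAP : ∀ g ∈ P, ∀ a ∈ A, g a ∈ A := by
    intro g hg a ha
    rw [hA, Finset.mem_sdiff, notMem_support] at ha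
    have hinv2 := apply_mem_orb_of_normalizer hyP ha.2
    have hm := card_modEq_sdiff_support hy hinv2
    obtain ⟨n, hn⟩ := card_orb_pgroup hP.pgroup a
    have hsub : orb P a ⊆ (fixedPts P)ᶜ := orb_subset (fun g hg =>
      apply_mem_compl_of_invariant fun b hb => by rwa [mem_fixedPts.1 hb g hg]) ha.1
    have hle := Finset.card_le_card hsub
    rw [hn, hcc] at hle
    have hn1 := orb_card_ne_one (Finset.mem_compl.1 ha.1)
    have : n = 1 := by
      rcases n with _ | _ | n
      · simp [hn] at hn1
      · rfl
      · have : 5 ^ 2 ≤ 5 ^ (n + 1 + 1) := Nat.pow_le_pow_right (by norm_num) (by omega)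
        omega
    subst this
    have hle2 := Finset.card_le_card (Finset.sdiff_subset (s := orb P a) (t := y.support))
    have heq : orb P a \ y.support = orb P a := Finset.eq_of_subset_of_card_le
      Finset.sdiff_subset (by unfold Nat.ModEq at hm; omega)
    have hga : g a ∈ orb P a := mem_orb.2 ⟨g, hg, rfl⟩
    rw [hA, Finset.mem_sdiff]
    exact ⟨hsub hga, by rw [← heq] at hga; exact (Finset.mem_sdiff.1 hga).2⟩
  have hA5 := card_modEq_inter_fixedPts hP.pgroup hAP
  have hemp : A ∩ fixedPts P = ∅ := by
    refine Finset.eq_empty_of_forall_notMem fun a ha => ?_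
    rw [hA, Finset.mem_inter, Finset.mem_sdiff, Finset.mem_compl] at ha
    exact ha.1.1 ha.2
  rw [hemp, Finset.card_empty] at hA5
  have hAsub : A ⊆ (fixedPts P)ᶜ := hA ▸ Finset.sdiff_subset
  have hAle := Finset.card_le_card hAsub
  have hAeq : A = (fixedPts P)ᶜ := Finset.eq_of_subset_of_card_le hAsub
    (by unfold Nat.ModEq at hc hA5; omega)
  have hsupp : y.support ⊆ fixedPts P := by
    intro a ha
    by_contra hna
    have : a ∈ A := hAeq ▸ Finset.mem_compl.2 hna
    rw [hA] at this
    exact (Finset.mem_sdiff.1 this).2 ha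
  have := Finset.card_le_card hsupp
  exact hG.false_of_card_support_lt hyG hy h7 (by norm_num) (by omega)

/-- An element of order 5 moves exactly 20 points. -/
theorem card_support_of_orderOf_eq_five {z : Perm (Fin 24)} (hz : z ∈ G) (h : orderOf z = 5) :
    z.support.card = 20 := by
  have h5 : Nat.Prime 5 := by norm_num
  have := Fact.mk h5
  have hd := dvd_card_support h5 h
  have hle := Finset.card_le_univ z.support
  rw [Fintype.card_fin] at hle
  by_contra hne
  obtain ⟨S, hS, hS5⟩ := Finset.exists_subset_card_eq (s := z.supportᶜ) (n := 5) (by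
    rw [Finset.card_compl, Fintype.card_fin]; omega)
  apply hG.not_five_dvd hS5
  rw [← h]
  exact orderOf_dvd_natCard (pointFixer G S) (x := z) ⟨hz, fun a ha => by
    simpa using hS ha⟩ 

end FiveNotSix

section Ten

variable {α : Type*} [Fintype α] [DecidableEq α]

theorem KTransOn.mono {G : Subgroup (Perm α)} {k l : ℕ} (h : KTransOn G Finset.univ k) (hl : l ≤ k)
    (hk : k ≤ Fintype.card α) : KTransOn G Finset.univ l :=
  have := h.isMultiplyPretransitive
  ktransOn_of_isMultiplyPretransitive
    (isMultiplyPretransitive_of_le (n := k) hl (by rwa [Nat.card_eq_fintype_card]))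

/-- A permutation commuting with a cycle acts on its support as a power of the cycle. -/
theorem IsCycle.exists_zpow_of_commute {y c : Perm α} (hy : y.IsCycle) (hc : c * y = y * c) :
    ∃ k : ℤ, ∀ a, y a ≠ a → c a = (y ^ k) a := by
  obtain ⟨a₀, h0, h1⟩ := hy
  have hcn : ∀ j : ℤ, ∀ a, c ((y ^ j) a) = (y ^ j) (c a) := by
    intro j a
    have : Commute c (y ^ j) := Commute.zpow_right hc j
    exact DFunLike.congr_fun this.eq a
  have h2 : y (c a₀) ≠ c a₀ := by
    intro h
    rw [← mul_apply, ← hc, mul_apply] at h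
    exact h0 (c.injective h)
  obtain ⟨k, hk⟩ := h1 h2
  refine ⟨k, fun a ha => ?_⟩
  obtain ⟨j, rfl⟩ := h1 ha
  rw [hcn, ← hk, ← mul_apply, ← mul_apply, ← zpow_add, ← zpow_add, add_comm]

theorem alternatingGroup_le_of_card_ten {R : Subgroup (Perm α)} (hα : Fintype.card α = 10)
    (hR : KTransOn R Finset.univ 5) : alternatingGroup α ≤ R := by
  have h7 : Nat.Prime 7 := by norm_num
  have := Fact.mk h7
  have hR3 := hR.mono (l := 3) (by norm_num) (by rw [hα]; norm_num)
  obtain ⟨s, -, hs⟩ := Finset.exists_subset_card_eq (s := (Finset.univ : Finset α))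
    (n := 3) (by rw [Finset.card_univ, hα]; norm_num)
  have hd : 7 ∣ Nat.card (pointFixer R s) := by
    have h1 := hR.descFactorial_dvd (by simp) (by rw [Finset.card_univ, hα]; norm_num)
    rw [hR3.card_eq hs, Finset.card_univ, hα] at h1
    have h2 : 7 ∣ 720 * Nat.card (pointFixer R s) := dvd_trans (by decide) h1
    exact (h7.dvd_mul.1 h2).resolve_left (by norm_num)
  obtain ⟨P, hP⟩ := exists_sylowAt R s h7
  have hf1 := hP.card_modEq h7
  have hf2 := hP.card_lt hd
  have hf3 := Finset.card_le_card hP.subset_fixedPts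
  rw [hα] at hf1 hf2
  have hfs : s = fixedPts P := Finset.eq_of_subset_of_card_le hP.subset_fixedPts
    (by unfold Nat.ModEq at hf1; omega)
  have hcard : Nat.card P = 7 := by
    obtain ⟨n, hn⟩ := hP.card_eq_pow h7
    have h1 : Nat.card P ∣ Nat.factorial 10 := by
      have := Subgroup.card_subgroup_dvd_card P
      rwa [Nat.card_eq_fintype_card (α := Perm α), Fintype.card_perm, hα] at this
    obtain _ | _ | n := n
    · obtain ⟨m, hm, hm7⟩ := hP.index
      rw [hm, hn, pow_zero, one_mul] at hd
      exact absurd hd hm7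
    · exact hn
    · rw [hn] at h1
      exact absurd ((pow_dvd_pow 7 (by omega : 2 ≤ n + 1 + 1)).trans h1) (by decide)
  obtain ⟨y, hyP, hy⟩ := exists_mem_orderOf_eq (M := P) (q := 7) (by rw [hcard])
  have hPy : zpowers y = P := Subgroup.eq_of_le_of_card_ge (by rwa [zpowers_le])
    (by rw [hcard, Nat.card_zpowers, hy])
  have hys : ∀ a, a ∉ s → y a ≠ a := by
    intro a ha h
    rw [hfs, ← hPy, mem_fixedPts_zpowers] at ha
    exact ha h
  have hsupp : y.support.card ≤ 7 := by
    have : y.support ⊆ sᶜ := fun a ha => Finset.mem_compl.2 fun hs' =>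
      mem_support.1 ha ((hP.le hyP).2 a hs')
    have := Finset.card_le_card this
    rwa [Finset.card_compl, hα, hs] at this
  have hyc : y.IsCycle := isCycle_of_prime_order (hy ▸ h7) (by rw [hy]; omega)
  have hw := hP.ktransOn hR3 hs
  let e := s.equivFinOfCardEq hs
  let x : Fin 3 ↪ α := e.symm.toEmbedding.trans (Function.Embedding.subtype _)
  have hxs : ∀ i, x i ∈ s := fun i => (e.symm i).2
  have hsx : ∀ a ∈ s, ∃ i, x i = a := fun a ha => ⟨e ⟨a, ha⟩, by simp [x]⟩
  obtain ⟨u, hu, hux⟩ := hw x ((Equiv.swap 0 1).toEmbedding.trans x) (fun i => hfs ▸ hxs i)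
    (fun i => hfs ▸ hxs _)
  obtain ⟨v, hv, hvx⟩ := hw x ((Equiv.swap 1 2).toEmbedding.trans x) (fun i => hfs ▸ hxs i)
    (fun i => hfs ▸ hxs _)
  have hu0 : u (x 0) = x 1 := hux 0
  have hu1 : u (x 1) = x 0 := hux 1
  have hu2 : u (x 2) = x 2 := hux 2
  have hv0 : v (x 0) = x 0 := hvx 0
  have hv1 : v (x 1) = x 2 := hvx 1
  have hv2 : v (x 2) = x 1 := hvx 2
  have huy := conj_mem_of_mem_normalizer hu.2 hyP
  have hvy := conj_mem_of_mem_normalizer hv.2 hyP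
  rw [← hPy] at huy hvy
  obtain ⟨i, hi⟩ := huy
  obtain ⟨j, hj⟩ := hvy
  simp only at hi hj
  have hcomm : (u * v) * y * (u * v)⁻¹ = (v * u) * y * (v * u)⁻¹ := by
    calc (u * v) * y * (u * v)⁻¹ = u * (v * y * v⁻¹) * u⁻¹ := by group
      _ = (u * y * u⁻¹) ^ j := by rw [← hj, conj_zpow]
      _ = (v * y * v⁻¹) ^ i := by rw [← hi, ← hj, ← zpow_mul, ← zpow_mul, mul_comm]
      _ = v * (u * y * u⁻¹) * v⁻¹ := by rw [← hi, conj_zpow]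
      _ = (v * u) * y * (v * u)⁻¹ := by group
  set c : Perm α := (v * u)⁻¹ * (u * v) with hcdef
  have hc : c * y = y * c := by
    calc c * y = (v * u)⁻¹ * ((u * v) * y * (u * v)⁻¹) * (u * v) := by rw [hcdef]; group
      _ = y * c := by rw [hcomm, hcdef]; group
  have hcR : c ∈ R := mul_mem (inv_mem (mul_mem hv.1 hu.1)) (mul_mem hu.1 hv.1)
  have hc0 : c (x 0) = x 2 := by
    rw [hcdef, mul_apply, inv_eq_iff_eq, mul_apply, mul_apply, hv0, hu0, hu2, hv2]
  have hc1 : c (x 1) = x 0 := by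
    rw [hcdef, mul_apply, inv_eq_iff_eq, mul_apply, mul_apply, hv1, hu2, hu0, hv1]
  have hc2 : c (x 2) = x 1 := by
    rw [hcdef, mul_apply, inv_eq_iff_eq, mul_apply, mul_apply, hv2, hu1, hv0]
  obtain ⟨k, hk⟩ := hyc.exists_zpow_of_commute hc
  have hcn : ∀ n : ℕ, ∀ a, y a ≠ a → (c ^ n) a = (y ^ (k * n)) a := by
    intro n
    induction n with
    | zero => simp
    | succ n ih =>
      intro a ha
      have h1 : y ((y ^ (k * n)) a) ≠ (y ^ (k * n)) a := by
        intro h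
        rw [← mul_apply, ← zpow_one_add, add_comm, zpow_add_one, mul_apply] at h
        exact ha ((y ^ (k * n)).injective h)
      rw [pow_succ', mul_apply, ih a ha, hk _ h1, ← mul_apply, ← zpow_add]
      congr 2
      push_cast
      ring
  have h70 : ∀ a, a ∉ s → (c ^ 7) a = a := by
    intro a ha
    rw [hcn 7 a (hys a ha), mul_comm, zpow_mul]
    have : y ^ ((7 : ℕ) : ℤ) = 1 := by rw [zpow_natCast, ← hy, pow_orderOf_eq_one]
    rw [this, one_zpow, one_apply]
  have hne : ∀ i, (c ^ 7) (x i) ≠ x i := by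
    intro i h
    have e0 : (c ^ 7) (x 0) = x 2 := by simp [pow_succ, hc0, hc1, hc2]
    have e1 : (c ^ 7) (x 1) = x 0 := by simp [pow_succ, hc0, hc1, hc2]
    have e2 : (c ^ 7) (x 2) = x 1 := by simp [pow_succ, hc0, hc1, hc2]
    fin_cases i
    · exact absurd (x.injective (e0.symm.trans h)) (by decide)
    · exact absurd (x.injective (e1.symm.trans h)) (by decide)
    · exact absurd (x.injective (e2.symm.trans h)) (by decide)
  have hsup : (c ^ 7).support = s := by
    ext a
    rw [mem_support]
    constructor
    · intro h
      by_contra ha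
      exact h (h70 a ha)
    · intro ha
      obtain ⟨i, rfl⟩ := hsx a ha
      exact hne i
  exact alternatingGroup_le_of_isPreprimitive_of_isThreeCycle_mem
    (hR.isPreprimitive (by norm_num) (by rw [hα]; norm_num))
    (card_support_eq_three_iff.1 (by rw [hsup, hs])) (pow_mem hcR 7)

end Ten

namespace FiveNotSix

variable {G : Subgroup (Perm (Fin 24))} (hG : FiveNotSix G)
include hG

theorem false_of_ktransOn_ten {N : Subgroup (Perm (Fin 24))} (hN : N ≤ G) {D : Finset (Fin 24)}
    (hD : D.card = 10) (hND : ∀ g ∈ N, ∀ a ∈ D, g a ∈ D) (h : KTransOn N D 5) : False := by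
  let R : Subgroup (Perm D) :=
    { carrier := {r | ∃ g ∈ N, ∀ a : D, g a = r a}
      mul_mem' := by
        rintro r r' ⟨g, hg, hr⟩ ⟨g', hg', hr'⟩
        exact ⟨g * g', mul_mem hg hg', fun a => by rw [mul_apply, mul_apply, hr', hr]⟩
      one_mem' := ⟨1, one_mem _, fun _ => rfl⟩
      inv_mem' := by
        rintro r ⟨g, hg, hr⟩
        exact ⟨g⁻¹, inv_mem hg, fun a => by rw [inv_eq_iff_eq, hr]; simp⟩ }
  have hcD : Fintype.card D = 10 := by rw [Fintype.card_coe, hD]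
  have hR : KTransOn R Finset.univ 5 := by
    intro x y _ _
    obtain ⟨g, hg, hgx⟩ := h (x.trans (Function.Embedding.subtype _))
      (y.trans (Function.Embedding.subtype _)) (fun i => (x i).2) (fun i => (y i).2)
    let r : Perm D := g.subtypePerm fun a => ⟨fun ha => by
      simpa using hND _ (inv_mem hg) _ ha, hND g hg a⟩
    exact ⟨r, ⟨g, hg, fun a => rfl⟩, fun i => Subtype.ext (hgx i)⟩
  have hA := alternatingGroup_le_of_card_ten hcD hR
  obtain ⟨σ, hσ⟩ := (exists_with_cycleType_iff D (m := {5})).2 (by rw [hcD]; simp)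
  have hσA : σ ∈ alternatingGroup D := by
    rw [mem_alternatingGroup, sign_of_cycleType, hσ]
    decide
  have hσ5 : orderOf σ = 5 := by rw [← lcm_cycleType, hσ]; simp
  have hσs : σ.support.card = 5 := by rw [← sum_cycleType, hσ]; simp
  obtain ⟨g, hg, hgσ⟩ := hA hσA
  let S : Finset (Fin 24) := σ.supportᶜ.map (Function.Embedding.subtype _)
  have hS : S.card = 5 := by
    rw [Finset.card_map, Finset.card_compl, hcD, hσs]
  apply hG.not_five_dvd hS
  have hgS : g ∈ pointFixer G S := by
    refine ⟨hN hg, fun a ha => ?_⟩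
    obtain ⟨b, hb, rfl⟩ := Finset.mem_map.1 ha
    rw [Finset.mem_compl, notMem_support] at hb
    exact (hgσ b).trans (congrArg Subtype.val hb)
  refine dvd_trans ?_ (Subgroup.orderOf_dvd_natCard _ hgS)
  rw [← hσ5, orderOf_dvd_iff_pow_eq_one]
  have key : ∀ n : ℕ, ∀ a : D, (g ^ n) a = (σ ^ n) a := by
    intro n
    induction n with
    | zero => intro a; rfl
    | succ n ih => intro a; rw [pow_succ, mul_apply, hgσ, ih, pow_succ, mul_apply]
  ext a
  rw [← key, pow_orderOf_eq_one]
  rfl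

end FiveNotSix

theorem card_normalizer_sylow_dvd {G : Subgroup (Perm (Fin 24))} (P : Sylow 23 G)
    (hP : Nat.card P = 23) : Nat.card (normalizer ((P : Subgroup G) : Set G)) ∣ 23 * 22 := by
  have h23 : Nat.Prime 23 := by norm_num
  have := Fact.mk h23
  obtain ⟨z, hz⟩ := exists_prime_orderOf_dvd_card' (G := P) 23 (by rw [hP])
  have hz1 : orderOf (z.1.1 : Perm (Fin 24)) = 23 := by
    rw [Subgroup.orderOf_coe, Subgroup.orderOf_coe, hz]
  let f := (P : Subgroup G).normalizerMonoidHom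
  have hcyc : IsCyclic P := isCyclic_of_prime_card hP
  have hr : Nat.card f.range ∣ 22 := by
    have h1 := Subgroup.card_subgroup_dvd_card f.range
    have h2 := IsCyclic.card_mulAut P
    rw [hP, Nat.totient_prime h23] at h2
    rwa [h2] at h1
  have hcen : Nat.card (centralizer {z.1.1}) ∣ 23 := by
    have hc : (z.1.1 : Perm (Fin 24)).IsCycle := isCycle_of_prime_order (by rw [hz1]; norm_num)
      (lt_of_le_of_lt (Finset.card_le_univ _) (by rw [hz1]; simp))
    have hct := hc.cycleType
    rw [← hc.orderOf, hz1] at hct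
    rw [nat_card_centralizer, hct]
    simp
  have hk : Nat.card f.ker ∣ 23 := by
    refine dvd_trans ?_ hcen
    let φ : f.ker →* centralizer {(z.1.1 : Perm (Fin 24))} :=
      { toFun := fun k => ⟨k.1.1.1, by
          rw [Subgroup.mem_centralizer_singleton_iff]
          have hk := DFunLike.congr_fun (MonoidHom.mem_ker.1 k.2) z
          have hk2 : k.1.1 * z.1 * (k.1.1)⁻¹ = z.1 := congrArg Subtype.val hk
          have := congrArg (Subtype.val : G → Perm (Fin 24)) (mul_inv_eq_iff_eq_mul.1 hk2)
          exact this⟩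
        map_one' := rfl
        map_mul' := fun _ _ => rfl }
    refine Subgroup.card_dvd_of_injective φ ?_
    intro a b hab
    have h : (φ a).1 = (φ b).1 := by rw [hab]
    exact Subtype.ext (Subtype.ext (Subtype.ext h))
  rw [← Subgroup.card_mul_index f.ker, Subgroup.index_ker]
  exact mul_dvd_mul hk hr

namespace FiveNotSix

variable {G : Subgroup (Perm (Fin 24))} (hG : FiveNotSix G)
include hG

theorem not_seven_dvd {S : Finset (Fin 24)} (hS : S.card = 5) :
    ¬ 7 ∣ Nat.card (pointFixer G S) := by
  intro hd
  have h7 : Nat.Prime 7 := by norm_num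
  obtain ⟨P, hP⟩ := exists_sylowAt G S h7
  have h1 := hP.card_modEq h7
  have h2 := hP.card_lt hd
  have h3 := hG.card_fixedPts_ne hS hP
  have h4 := Finset.card_le_card hP.subset_fixedPts
  simp only [Finset.mem_insert, Finset.mem_singleton, not_or, Nat.ModEq, Fintype.card_fin] at *
  exact hG.false_of_ktransOn_ten inf_le_left (by omega)
    (fun _ hg _ ha => apply_mem_fixedPts hg.2 ha) (hP.ktransOn hG.five hS)

theorem exists_card_eq {S : Finset (Fin 24)} (hS : S.card = 5) :
    ∃ a ≤ 16, ∃ b ≤ 8, Nat.card (pointFixer G S) = 2 ^ a * 3 ^ b := by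
  have h1 : Nat.card (pointFixer G S) ∣ 2 ^ 16 * 3 ^ 8 * (5 ^ 3 * 7 ^ 2 * (11 * 13 * 17 * 19)) := by
    have h := Subgroup.card_subgroup_dvd_card G
    rw [Nat.card_eq_fintype_card (α := Perm _), Fintype.card_perm, Fintype.card_fin,
      hG.card_eq hS] at h
    refine Nat.dvd_of_mul_dvd_mul_left (k := 5100480) (by norm_num) (h.trans ?_)
    decide
  have cop : ∀ q : ℕ, q.Prime → ¬ q ∣ Nat.card (pointFixer G S) →
      Nat.Coprime (Nat.card (pointFixer G S)) q :=
    fun q hq hd => ((Nat.Prime.coprime_iff_not_dvd hq).2 hd).symm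
  have c5 := cop 5 (by norm_num) (hG.not_five_dvd hS)
  have c7 := cop 7 (by norm_num) (hG.not_seven_dvd hS)
  have c11 := cop 11 (by norm_num) (hG.not_dvd_of_le hS (by norm_num) (by norm_num))
  have c13 := cop 13 (by norm_num) (hG.not_dvd_of_le hS (by norm_num) (by norm_num))
  have c17 := cop 17 (by norm_num) (hG.not_dvd_of_le hS (by norm_num) (by norm_num))
  have c19 := cop 19 (by norm_num) (hG.not_dvd_of_le hS (by norm_num) (by norm_num))
  have h2 := Nat.Coprime.dvd_of_dvd_mul_right (((c5.pow_right 3).mul_right (c7.pow_right 2)).mul_right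
    (((c11.mul_right c13).mul_right c17).mul_right c19)) h1
  obtain ⟨d, e, hd, he, hde⟩ := (Nat.dvd_mul).1 h2
  obtain ⟨a, ha, rfl⟩ := (Nat.dvd_prime_pow (by norm_num)).1 hd
  obtain ⟨b, hb, rfl⟩ := (Nat.dvd_prime_pow (by norm_num)).1 he
  exact ⟨a, ha, b, hb, hde.symm⟩

theorem card_pointFixer_mod {S : Finset (Fin 24)} (hS : S.card = 5) :
    Nat.card (pointFixer G S) % 23 ∈ ({2, 4, 15, 19} : Finset ℕ) := by
  have h23 : Nat.Prime 23 := by norm_num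
  have := Fact.mk h23
  have hc := hG.card_eq hS
  have hnd := hG.not_dvd_of_le hS h23 (by norm_num)
  obtain ⟨P⟩ : Nonempty (Sylow 23 G) := inferInstance
  have hP : Nat.card P = 23 := by
    obtain ⟨n, hn⟩ := IsPGroup.iff_card.1 P.2
    have hi := P.not_dvd_index
    have hm := Subgroup.card_mul_index (P : Subgroup G)
    change Nat.card P = _ at hn
    change Nat.card P * _ = _ at hm
    rw [hn, hc] at hm
    obtain _ | _ | n := n
    · rw [pow_zero, one_mul] at hm
      exact absurd (hm ▸ Dvd.intro (221760 * Nat.card (pointFixer G S)) (by ring)) hi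
    · exact hn
    · exfalso
      apply hnd
      have h1 : 23 * 23 ∣ 5100480 * Nat.card (pointFixer G S) :=
        hm ▸ Dvd.intro (23 ^ n * (P : Subgroup G).index) (by ring)
      have h2 : 23 ∣ 221760 * Nat.card (pointFixer G S) :=
        Nat.dvd_of_mul_dvd_mul_left (k := 23) (by norm_num) (by
          rw [← mul_assoc]; exact h1)
      exact (h23.dvd_mul.1 h2).resolve_left (by norm_num)
  have hN := card_normalizer_sylow_dvd P hP
  have hPN : 23 ∣ Nat.card (normalizer ((P : Subgroup G) : Set G)) := by
    have := Subgroup.card_dvd_of_le (Subgroup.le_normalizer (H := (P : Subgroup G)))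
    rwa [show Nat.card (P : Subgroup G) = 23 from hP] at this
  obtain ⟨m, hm⟩ := hPN
  rw [hm] at hN
  have hm22 := Nat.dvd_of_mul_dvd_mul_left (by norm_num) hN
  have hn := card_sylow_modEq_one 23 G
  have hi := Subgroup.card_mul_index (normalizer ((P : Subgroup G) : Set G))
  rw [Sylow.card_eq_index_normalizer P] at hn
  rw [hm, hc] at hi
  have hi2 : m * (normalizer ((P : Subgroup G) : Set G)).index =
      221760 * Nat.card (pointFixer G S) := by
    rw [mul_assoc] at hi
    omega
  have hmod : m ≡ 221760 * Nat.card (pointFixer G S) [MOD 23] := by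
    rw [← hi2]
    simpa using (Nat.ModEq.refl m).mul hn.symm
  have hmem : m ∈ Nat.divisors 22 := Nat.mem_divisors.2 ⟨hm22, by norm_num⟩
  have hdiv : Nat.divisors 22 = {1, 2, 11, 22} := by decide
  rw [hdiv] at hmem
  simp only [Finset.mem_insert, Finset.mem_singleton, Nat.ModEq] at *
  omega

end FiveNotSix

section Centralizer

variable {α : Type*} [Fintype α] [DecidableEq α]

open scoped Classical in
theorem card_modEq_inf_centralizer {p : ℕ} [Fact p.Prime] {z : Perm α} (hz : z ^ p = 1)
    {P : Subgroup (Perm α)} (hP : z ∈ normalizer (P : Set (Perm α))) :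
    Nat.card P ≡ Nat.card (P ⊓ centralizer {z} : Subgroup (Perm α)) [MOD p] := by
  have h := card_modEq_commute hz (Finset.univ.filter (· ∈ P)) (fun g hg => by
    simp only [Finset.mem_filter, Finset.mem_univ, true_and] at *
    exact conj_mem_of_mem_normalizer hP hg)
  have e1 : Nat.card P = (Finset.univ.filter (· ∈ P)).card := by
    rw [Nat.card_eq_fintype_card, Fintype.card_subtype]
  have e2 : Nat.card (P ⊓ centralizer {z} : Subgroup (Perm α)) =
      ((Finset.univ.filter (· ∈ P)).filter fun g => z * g = g * z).card := by
    rw [Nat.card_eq_fintype_card, Fintype.card_subtype, Finset.filter_filter]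
    congr 1
    ext g
    simp only [Finset.mem_filter, Finset.mem_univ, true_and, Subgroup.mem_inf,
      mem_centralizer_singleton_iff]
    exact and_congr_right fun _ => eq_comm
  rwa [e1, e2]

/-- If `z` of prime order `p` moves every point of an invariant set, `p` divides its size. -/
theorem dvd_card_of_subset_support {p : ℕ} [Fact p.Prime] {z : Perm α} (hz : orderOf z = p)
    {A : Finset α} (hA : ∀ a ∈ A, z a ∈ A) (hs : A ⊆ z.support) : p ∣ A.card := by
  have h := card_modEq_sdiff_support hz hA
  rw [Finset.sdiff_eq_empty_iff_subset.2 hs, Finset.card_empty] at h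
  exact Nat.modEq_zero_iff_dvd.1 h

end Centralizer

namespace FiveNotSix

variable {G : Subgroup (Perm (Fin 24))} (hG : FiveNotSix G)
include hG

theorem exists_five_normalizer {S : Finset (Fin 24)} (hS : S.card = 5) {p : ℕ}
    {P : Subgroup (Perm (Fin 24))} (hP : SylowAt G S p P) :
    ∃ z ∈ G, z ∈ normalizer (P : Set (Perm (Fin 24))) ∧ orderOf z = 5 := by
  refine hP.exists_orderOf_eq hG.five hS (by norm_num) ?_
  exact dvd_trans (by decide : 5 ∣ Nat.factorial 5) (Nat.factorial_dvd_descFactorial _ 5)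

theorem two_dvd {S : Finset (Fin 24)} (hS : S.card = 5) : 2 ∣ Nat.card (pointFixer G S) := by
  by_contra hodd
  have h3 : Nat.Prime 3 := by norm_num
  have h5 : Nat.Prime 5 := by norm_num
  have := Fact.mk h3
  have := Fact.mk h5
  have hmod := hG.card_pointFixer_mod hS
  obtain ⟨a, ha, b, hb, hab⟩ := hG.exists_card_eq hS
  have ha0 : a = 0 := by
    rcases a with _ | a
    · rfl
    · exact absurd (hab ▸ Dvd.intro (2 ^ a * 3 ^ b) (by ring)) hodd
  rw [ha0, pow_zero, one_mul] at hab
  obtain ⟨P, hP⟩ := exists_sylowAt G S h3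
  have hPc : Nat.card P = 3 ^ b := by
    obtain ⟨m, hm, h3m⟩ := hP.index
    rw [hab] at hm
    have : m = 1 := by
      obtain ⟨k, hk, rfl⟩ := (Nat.dvd_prime_pow h3).1 (hm ▸ Dvd.intro_left _ rfl : m ∣ 3 ^ b)
      rcases k with _ | k
      · rfl
      · exact absurd (Dvd.intro (3 ^ k) (by ring)) h3m
    rw [hm, this, mul_one]
  have hP5 : 3 ^ b % 5 = 2 := by
    rw [hab] at hmod
    clear hab hPc
    interval_cases b <;> revert hmod <;> decide
  obtain ⟨z, hzG, hzP, hz⟩ := hG.exists_five_normalizer hS hP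
  have hC := card_modEq_inf_centralizer (p := 5) (by rw [← hz, pow_orderOf_eq_one]) hzP
  obtain ⟨C, hCdef⟩ : ∃ C, C = P ⊓ centralizer {z} := ⟨_, rfl⟩
  rw [← hCdef] at hC
  have hCP : C ≤ P := hCdef ▸ inf_le_left
  have hCz : ∀ g ∈ C, ∀ a, g (z a) = z (g a) := by
    intro g hg a
    rw [hCdef] at hg
    exact DFunLike.congr_fun (mem_centralizer_singleton_iff.1 hg.2) a
  have hCp : IsPGroup 3 C := hP.pgroup.to_le hCP
  have hM := hG.card_support_of_orderOf_eq_five hzG hz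
  have hfix : ∀ Q ≤ C, (z.support ∩ fixedPts Q).card = 5 ∨ (z.support ∩ fixedPts Q).card = 20 := by
    intro Q hQ
    have h1 := card_modEq_inter_fixedPts (hCp.to_le hQ) (A := z.support) (fun g hg a ha => by
      rw [mem_support, ← hCz g (hQ hg)]
      exact fun h => mem_support.1 ha (g.injective h))
    have h2 := dvd_card_of_subset_support hz (A := z.support ∩ fixedPts Q) (fun a ha => by
      rw [Finset.mem_inter] at *
      refine ⟨apply_mem_support.2 ha.1, mem_fixedPts.2 fun g hg => ?_⟩
      rw [hCz g (hQ hg), mem_fixedPts.1 ha.2 g hg]) Finset.inter_subset_left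
    have h3 := Finset.card_le_card (Finset.inter_subset_left (s₁ := z.support) (s₂ := fixedPts Q))
    rw [hM] at h1 h3
    unfold Nat.ModEq at h1
    omega
  have htriv : ∀ Q ≤ C, (z.support ∩ fixedPts Q).card = 20 → Nat.card Q = 1 := by
    intro Q hQ h20
    obtain ⟨n, hn⟩ := IsPGroup.iff_card.1 (hCp.to_le hQ)
    rcases n with _ | n
    · exact hn
    · exfalso
      obtain ⟨g, hg, hg3⟩ := exists_mem_orderOf_eq (M := Q) (q := 3)
        (hn ▸ Dvd.intro (3 ^ n) (by ring))
      have heq : z.support ∩ fixedPts Q = z.support :=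
        Finset.eq_of_subset_of_card_le Finset.inter_subset_left (by rw [h20, hM])
      have hsub : g.support ⊆ z.supportᶜ := by
        intro a ha
        rw [Finset.mem_compl, ← heq]
        intro h
        exact mem_support.1 ha (mem_fixedPts.1 (Finset.mem_inter.1 h).2 g hg)
      have hle := Finset.card_le_card hsub
      rw [Finset.card_compl, hM, Fintype.card_fin] at hle
      exact hG.false_of_card_support_lt (hP.le_group (hCP (hQ hg))) hg3 h3 (by norm_num)
        (by omega)
  obtain ⟨c, hc⟩ := IsPGroup.iff_card.1 hCp
  have hC27 : 27 ≤ Nat.card C := by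
    rw [hPc, hc] at hC
    rw [hc]
    unfold Nat.ModEq at hC
    obtain _ | _ | _ | c := c
    · omega
    · omega
    · omega
    · rw [show c + 1 + 1 + 1 = c + 3 by ring, pow_add]
      have := Nat.one_le_pow c 3 (by norm_num)
      omega
  rcases hfix C le_rfl with h | h
  · obtain ⟨b, hb, hbC⟩ : ∃ b ∈ z.support, b ∉ z.support ∩ fixedPts C := by
      by_contra! hcon
      have := Finset.card_le_card (show z.support ⊆ _ from hcon)
      omega
    have hQ : (z.support ∩ fixedPts (pointFixer C {b})).card = 20 := by
      refine (hfix _ (pointFixer_le _ _)).resolve_left fun h5 => ?_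
      have hsub : insert b (z.support ∩ fixedPts C) ⊆
          z.support ∩ fixedPts (pointFixer C {b}) := by
        intro x hx
        rw [Finset.mem_insert] at hx
        rw [Finset.mem_inter]
        rcases hx with rfl | hx
        · exact ⟨hb, mem_fixedPts.2 fun g hg => hg.2 x (Finset.mem_singleton_self x)⟩
        · rw [Finset.mem_inter] at hx
          exact ⟨hx.1, mem_fixedPts.2 fun g hg => mem_fixedPts.1 hx.2 g hg.1⟩
      have := Finset.card_le_card hsub
      rw [Finset.card_insert_of_notMem hbC] at this
      omega
    have h1 := card_orb_mul C b
    rw [htriv _ (pointFixer_le _ _) hQ, mul_one] at h1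
    have := Finset.card_le_univ (orb C b)
    rw [Fintype.card_fin] at this
    omega
  · have := htriv C le_rfl h
    omega

end FiveNotSix

section Orbits

variable {α : Type*} [Fintype α] [DecidableEq α]

theorem orb_eq_of_mem {P : Subgroup (Perm α)} {a b : α} (h : b ∈ orb P a) : orb P b = orb P a := by
  obtain ⟨g, hg, rfl⟩ := mem_orb.1 h
  ext c
  rw [mem_orb, mem_orb]
  constructor
  · rintro ⟨k, hk, rfl⟩
    exact ⟨k * g, mul_mem hk hg, rfl⟩
  · rintro ⟨k, hk, rfl⟩
    exact ⟨k * g⁻¹, mul_mem hk (inv_mem hg), by simp⟩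

theorem orb_mono {P H : Subgroup (Perm α)} (h : P ≤ H) (a : α) : orb P a ⊆ orb H a := by
  intro b hb
  obtain ⟨g, hg, rfl⟩ := mem_orb.1 hb
  exact mem_orb.2 ⟨g, h hg, rfl⟩

theorem orb_pointFixer_subset {G : Subgroup (Perm α)} {S : Finset α} {a : α} (ha : a ∉ S) :
    orb (pointFixer G S) a ⊆ Sᶜ :=
  orb_subset (fun _ hg => apply_mem_compl_of_invariant fun b hb => by rwa [hg.2 b hb])
    (Finset.mem_compl.2 ha)

theorem orb_subset_compl_fixedPts {P : Subgroup (Perm α)} {a : α} (ha : a ∉ fixedPts P) :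
    orb P a ⊆ (fixedPts P)ᶜ :=
  orb_subset (fun g hg => apply_mem_compl_of_invariant fun b hb => by
    rwa [mem_fixedPts.1 hb g hg]) (Finset.mem_compl.2 ha)

open scoped Classical in
/-- The number of elements of `P` mapping `a` to a given point of its orbit. -/
theorem card_filter_apply_eq {P : Subgroup (Perm α)} {a b : α} (hb : b ∈ orb P a) :
    (Finset.univ.filter fun t => t ∈ P ∧ t a = b).card = Nat.card (pointFixer P {a}) := by
  obtain ⟨g, hg, rfl⟩ := mem_orb.1 hb
  rw [← Fintype.card_subtype, ← Nat.card_eq_fintype_card]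
  refine Nat.card_congr ⟨fun t => ⟨g⁻¹ * t.1, mul_mem (inv_mem hg) t.2.1, fun c hc => ?_⟩,
    fun t => ⟨g * t.1, mul_mem hg t.2.1, ?_⟩, fun t => ?_, fun t => ?_⟩
  · rw [Finset.mem_singleton.1 hc, mul_apply, t.2.2]; simp
  · rw [mul_apply, t.2.2 a (Finset.mem_singleton_self a)]
  · simp
  · simp

/-- If `z` normalizes the `p`-group `P` and fixes two points in the same orbit, some element of `P`
commuting with `z` maps the first to the second. -/
theorem exists_commute_apply_eq {p q : ℕ} (hp : p.Prime) (hq : q.Prime) (hpq : p ≠ q)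
    {P : Subgroup (Perm α)} (hP : IsPGroup p P) {z : Perm α}
    (hzP : z ∈ normalizer (P : Set (Perm α))) (hz : orderOf z = q) {a b : α} (ha : z a = a)
    (hb : z b = b) (hab : b ∈ orb P a) : ∃ t ∈ P, t a = b ∧ z * t = t * z := by
  classical
  have := Fact.mk hp
  have := Fact.mk hq
  obtain ⟨t, ht, htz⟩ := exists_commute_of_not_dvd (p := q) (by rw [← hz, pow_orderOf_eq_one])
    (Finset.univ.filter fun t => t ∈ P ∧ t a = b) (fun g hg => by
      simp only [Finset.mem_filter, Finset.mem_univ, true_and] at *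
      refine ⟨conj_mem_of_mem_normalizer hzP hg.1, ?_⟩
      rw [mul_apply, mul_apply, inv_eq_iff_eq.2 ha.symm, hg.2, hb]) (by
      rw [card_filter_apply_eq hab]
      obtain ⟨n, hn⟩ := IsPGroup.iff_card.1 (hP.to_le (pointFixer_le P {a}))
      rw [hn]
      exact fun h => hpq ((Nat.prime_dvd_prime_iff_eq hq hp).1 (hq.dvd_of_dvd_pow h)).symm)
  simp only [Finset.mem_filter, Finset.mem_univ, true_and] at ht
  exact ⟨t, ht.1, ht.2, htz⟩

theorem SylowAt.pow_dvd_card_orb {G : Subgroup (Perm α)} {S : Finset α} {p : ℕ} (hp : p.Prime)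
    {P : Subgroup (Perm α)} (hP : SylowAt G S p P) {k : ℕ} {a : α}
    (h : p ^ k ∣ (orb (pointFixer G S) a).card) : p ^ k ∣ (orb P a).card := by
  obtain ⟨m, hm, hpm⟩ := hP.index
  have hsub : pointFixer P {a} ≤ pointFixer (pointFixer G S) {a} :=
    fun g hg => ⟨hP.le hg.1, hg.2⟩
  obtain ⟨l, hl⟩ := Subgroup.card_dvd_of_le hsub
  have h1 := card_orb_mul (pointFixer G S) a
  have h2 := card_orb_mul P a
  rw [hm, ← h2, hl] at h1
  have hpos : 0 < Nat.card (pointFixer P {a}) := Nat.card_pos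
  have h3 : (orb (pointFixer G S) a).card * l = (orb P a).card * m :=
    Nat.eq_of_mul_eq_mul_left hpos (by linarith)
  refine Nat.Coprime.dvd_of_dvd_mul_right ?_ (h3 ▸ h.mul_right l)
  exact Nat.Coprime.pow_left k ((Nat.Prime.coprime_iff_not_dvd hp).2 hpm)

end Orbits

namespace FiveNotSix

variable {G : Subgroup (Perm (Fin 24))} (hG : FiveNotSix G)
include hG

theorem card_fixedPts_two {S : Finset (Fin 24)} (hS : S.card = 5) {P : Subgroup (Perm (Fin 24))}
    (hP : SylowAt G S 2 P) : (fixedPts P).card = 6 ∨ (fixedPts P).card = 8 := by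
  have h2 : Nat.Prime 2 := by norm_num
  have h11 : Nat.Prime 11 := by norm_num
  have := Fact.mk h2
  have := Fact.mk h11
  have h1 := hP.card_modEq h2
  have h3 := hP.card_lt (hG.two_dvd hS)
  have h4 := hG.card_fixedPts_ne hS hP
  have h5 := Finset.card_le_card hP.subset_fixedPts
  simp only [Finset.mem_insert, Finset.mem_singleton, not_or, Nat.ModEq, Fintype.card_fin] at *
  have h10 : (fixedPts P).card ≠ 10 := fun h => hG.false_of_ktransOn_ten inf_le_left h
    (fun _ hg _ ha => apply_mem_fixedPts hg.2 ha) (hP.ktransOn hG.five hS)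
  suffices (fixedPts P).card ≠ 12 by omega
  intro hf
  obtain ⟨y, hyG, hyP, hy⟩ := hP.exists_orderOf_eq hG.five hS h11 (by rw [hf]; decide)
  have hc := card_modEq_sdiff_support hy (A := (fixedPts P)ᶜ)
    (apply_mem_compl_of_invariant fun a ha => apply_mem_fixedPts hyP ha)
  have hcc : (fixedPts P)ᶜ.card = 12 := by rw [Finset.card_compl, hf]; rfl
  obtain ⟨A, hA⟩ : ∃ A, A = (fixedPts P)ᶜ \ y.support := ⟨_, rfl⟩
  rw [← hA, hcc] at hc
  have hAle := Finset.card_le_card (show A ⊆ (fixedPts P)ᶜ from hA ▸ Finset.sdiff_subset)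
  obtain ⟨x, hx⟩ : A.Nonempty := by
    rw [← Finset.card_pos]
    unfold Nat.ModEq at hc
    omega
  have hx' := hx
  rw [hA, Finset.mem_sdiff, Finset.mem_compl, notMem_support] at hx'
  have hsub := orb_subset_compl_fixedPts hx'.1
  have hle := Finset.card_le_card hsub
  have hm := card_modEq_sdiff_support hy (apply_mem_orb_of_normalizer hyP hx'.2)
  obtain ⟨n, hn⟩ := card_orb_pgroup hP.pgroup x
  have hn1 := orb_card_ne_one hx'.1
  have hn11 : 2 ≤ (orb P x).card ∧ (orb P x).card < 11 := by
    rw [hcc, hn] at hle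
    rw [hn] at hn1
    rw [hn]
    obtain _ | _ | _ | _ | n := n
    · simp at hn1
    · norm_num
    · norm_num
    · norm_num
    · exfalso
      have : 2 ^ 4 ≤ 2 ^ (n + 1 + 1 + 1 + 1) := Nat.pow_le_pow_right (by norm_num) (by omega)
      omega
  have hle2 := Finset.card_le_card (Finset.sdiff_subset (s := orb P x) (t := y.support))
  have heq : (orb P x \ y.support).card = (orb P x).card := by
    unfold Nat.ModEq at hm
    omega
  have hle3 := Finset.card_le_card (show orb P x \ y.support ⊆ A from
    hA ▸ Finset.sdiff_subset_sdiff hsub le_rfl)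
  have hA12 : A.card = 12 := by
    unfold Nat.ModEq at hc
    omega
  have hsupp : y.support ⊆ Aᶜ := by
    intro a ha
    rw [Finset.mem_compl, hA, Finset.mem_sdiff]
    exact fun h => h.2 ha
  have := Finset.card_le_card hsupp
  rw [Finset.card_compl, Fintype.card_fin] at this
  exact hG.false_of_card_support_lt hyG hy h11 (by norm_num) (by omega)

theorem card_sdiff_support_add {z : Perm (Fin 24)} (hzG : z ∈ G) (hz : orderOf z = 5)
    (A : Finset (Fin 24)) : (A \ z.support).card + (Aᶜ \ z.support).card = 4 := by
  have h := hG.card_support_of_orderOf_eq_five hzG hz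
  have h1 := Finset.card_compl z.support
  have e1 : A \ z.support = z.supportᶜ.filter (· ∈ A) := by
    ext; simp [and_comm]
  have e2 : Aᶜ \ z.support = z.supportᶜ.filter (· ∉ A) := by
    ext; simp [and_comm]
  rw [e1, e2, Finset.card_filter_add_card_filter_not, h1, h, Fintype.card_fin]

theorem exists_card_orb_eq {S : Finset (Fin 24)} (hS : S.card = 5) {P : Subgroup (Perm (Fin 24))}
    (hP : SylowAt G S 2 P) :
    ∃ z ∈ G, z ∈ normalizer (P : Set (Perm (Fin 24))) ∧ orderOf z = 5 ∧
      ∃ w, z w = w ∧ (orb P w).card = 16 := by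
  have h2 : Nat.Prime 2 := by norm_num
  have h5 : Nat.Prime 5 := by norm_num
  have := Fact.mk h2
  have := Fact.mk h5
  obtain ⟨z, hzG, hzP, hz⟩ := hG.exists_five_normalizer hS hP
  refine ⟨z, hzG, hzP, hz, ?_⟩
  have hm := card_modEq_sdiff_support hz (A := fixedPts P) (fun a ha => apply_mem_fixedPts hzP ha)
  have hadd := hG.card_sdiff_support_add hzG hz (fixedPts P)
  have hf := hG.card_fixedPts_two hS hP
  obtain ⟨A, hA⟩ : ∃ A, A = (fixedPts P)ᶜ \ z.support := ⟨_, rfl⟩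
  rw [← hA] at hadd
  have hodd : A.card % 2 = 1 := by
    unfold Nat.ModEq at hm
    omega
  have hCA := card_modEq_inter_fixedPts (hP.pgroup.to_le (inf_le_left (b := centralizer {z})))
    (A := A) (fun g hg a ha => by
      rw [hA, Finset.mem_sdiff, notMem_support] at *
      refine ⟨apply_mem_compl_of_invariant (fun b hb => by
        rwa [mem_fixedPts.1 hb g hg.1]) a ha.1, ?_⟩
      have := DFunLike.congr_fun (mem_centralizer_singleton_iff.1 hg.2) a
      rw [mul_apply, mul_apply, ha.2] at this
      exact this.symm)
  obtain ⟨w, hw⟩ : (A ∩ fixedPts (P ⊓ centralizer {z})).Nonempty := by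
    rw [← Finset.card_pos]
    unfold Nat.ModEq at hCA
    omega
  rw [Finset.mem_inter, hA, Finset.mem_sdiff, Finset.mem_compl, notMem_support] at hw
  obtain ⟨⟨hwP, hzw⟩, hwC⟩ := hw
  refine ⟨w, hzw, ?_⟩
  have hone : orb P w \ z.support = {w} := by
    ext b
    rw [Finset.mem_sdiff, Finset.mem_singleton, notMem_support]
    constructor
    · rintro ⟨hb, hzb⟩
      obtain ⟨t, htP, rfl, htz⟩ := exists_commute_apply_eq h2 h5 (by norm_num) hP.pgroup hzP hz
        hzw hzb hb
      exact mem_fixedPts.1 hwC t ⟨htP, mem_centralizer_singleton_iff.2 htz.symm⟩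
    · rintro rfl
      exact ⟨self_mem_orb P b, hzw⟩
  have hmo := card_modEq_sdiff_support hz (apply_mem_orb_of_normalizer hzP hzw)
  rw [hone, Finset.card_singleton] at hmo
  obtain ⟨n, hn⟩ := card_orb_pgroup hP.pgroup w
  have hle := Finset.card_le_univ (orb P w)
  have hn1 := orb_card_ne_one hwP
  rw [Fintype.card_fin] at hle
  rw [hn] at hle hn1 hmo
  rw [hn]
  unfold Nat.ModEq at hmo
  have hn5 : n < 5 := by
    by_contra! h
    have := Nat.pow_le_pow_right (n := 2) (by norm_num) h
    omega
  interval_cases n <;> omega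

theorem card_orb_ne_eighteen {S : Finset (Fin 24)} (hS : S.card = 5) {w : Fin 24} :
    (orb (pointFixer G S) w).card ≠ 18 := by
  intro h18
  have h3 : Nat.Prime 3 := by norm_num
  have h5 : Nat.Prime 5 := by norm_num
  have := Fact.mk h3
  have := Fact.mk h5
  obtain ⟨P, hP⟩ := exists_sylowAt G S h3
  have hO : ∀ x ∈ orb (pointFixer G S) w, (orb P x).card = 9 := by
    intro x hx
    have h9 : 3 ^ 2 ∣ (orb P x).card := hP.pow_dvd_card_orb h3 (by
      rw [orb_eq_of_mem hx, h18]; norm_num)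
    have hle := Finset.card_le_card ((orb_mono hP.le x).trans (orb_eq_of_mem hx).le)
    rw [h18] at hle
    obtain ⟨n, hn⟩ := card_orb_pgroup hP.pgroup x
    rw [hn] at h9 hle ⊢
    have hn3 : n < 3 := by
      by_contra! h
      have := Nat.pow_le_pow_right (n := 3) (by norm_num) h
      omega
    interval_cases n <;> revert h9 <;> decide
  have hdis : fixedPts P ⊆ (orb (pointFixer G S) w)ᶜ := by
    intro x hx
    rw [Finset.mem_compl]
    intro hxo
    have h1 := hO x hxo
    have h2 : orb P x ⊆ {x} := orb_subset (fun g hg a ha => by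
      rw [Finset.mem_singleton] at *
      rw [ha, mem_fixedPts.1 hx g hg]) (Finset.mem_singleton_self x)
    have := Finset.card_le_card h2
    rw [h1, Finset.card_singleton] at this
    omega
  have hle := Finset.card_le_card hdis
  have hge := Finset.card_le_card hP.subset_fixedPts
  have hm := hP.card_modEq h3
  rw [Finset.card_compl, h18, Fintype.card_fin] at hle
  rw [Fintype.card_fin] at hm
  have hf : (fixedPts P).card = 6 := by
    unfold Nat.ModEq at hm
    omega
  have heq : fixedPts P = (orb (pointFixer G S) w)ᶜ := Finset.eq_of_subset_of_card_le hdis (by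
    rw [Finset.card_compl, h18, Fintype.card_fin, hf])
  obtain ⟨z, hzG, hzP, hz⟩ := hG.exists_five_normalizer hS hP
  have hmz := card_modEq_sdiff_support hz (A := fixedPts P) (fun a ha => apply_mem_fixedPts hzP ha)
  have hadd := hG.card_sdiff_support_add hzG hz (fixedPts P)
  have hcard : ((fixedPts P)ᶜ \ z.support).card = 3 := by
    unfold Nat.ModEq at hmz
    omega
  obtain ⟨x, hx⟩ : ((fixedPts P)ᶜ \ z.support).Nonempty := by
    rw [← Finset.card_pos]; omega
  rw [Finset.mem_sdiff, notMem_support] at hx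
  have hxO : x ∈ orb (pointFixer G S) w := by
    have := hx.1
    rwa [heq, compl_compl] at this
  have hmo := card_modEq_sdiff_support hz (apply_mem_orb_of_normalizer hzP hx.2)
  have hsub := Finset.card_le_card (Finset.sdiff_subset_sdiff
    (orb_subset_compl_fixedPts (Finset.mem_compl.1 hx.1)) (le_refl z.support))
  rw [hO x hxO] at hmo
  unfold Nat.ModEq at hmo
  omega

theorem card_orb_eq_sixteen {S : Finset (Fin 24)} (hS : S.card = 5) {P : Subgroup (Perm (Fin 24))}
    (hP : SylowAt G S 2 P) {w : Fin 24} (hw : (orb P w).card = 16) :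
    orb (pointFixer G S) w = orb P w ∧ w ∉ S := by
  have hwS : w ∉ S := by
    intro h
    have h2 : orb P w ⊆ {w} := orb_subset (fun g hg a ha => by
      rw [Finset.mem_singleton] at *
      rw [ha, (hP.le hg).2 w h]) (Finset.mem_singleton_self w)
    have := Finset.card_le_card h2
    rw [hw, Finset.card_singleton] at this
    omega
  refine ⟨(Finset.eq_of_subset_of_card_le (orb_mono hP.le w) ?_).symm, hwS⟩
  have h1 := Finset.card_le_card (orb_pointFixer_subset (G := G) hwS)
  rw [Finset.card_compl, hS, Fintype.card_fin] at h1
  have h2 := hG.card_orb_ne hS hwS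
  have h3 := hG.card_orb_ne_eighteen hS (w := w)
  have h4 : (orb (pointFixer G S) w).card ≠ 17 := by
    intro h17
    apply hG.not_dvd_of_le hS (q := 17) (by norm_num) (by norm_num)
    rw [← card_orb_mul _ w, h17]
    exact Dvd.intro _ rfl
  omega

end FiveNotSix

/-- `B` is the octad determined by the five points `S`: the complement of the orbit of length 16
of the pointwise stabilizer of `S`. -/
structure IsOctad (G : Subgroup (Perm (Fin 24))) (S B : Finset (Fin 24)) : Prop where
  card_base : S.card = 5
  subset : S ⊆ B
  card : B.card = 8
  apply_mem : ∀ g ∈ pointFixer G S, ∀ b ∈ B, g b ∈ B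
  orb_eq : ∀ P, SylowAt G S 2 P → ∀ x ∉ B, orb P x = Bᶜ

namespace IsOctad

variable {G : Subgroup (Perm (Fin 24))} {S B : Finset (Fin 24)}

theorem card_compl (h : IsOctad G S B) : Bᶜ.card = 16 := by
  rw [Finset.card_compl, h.card, Fintype.card_fin]

theorem fixedPts_subset (h : IsOctad G S B) {P : Subgroup (Perm (Fin 24))}
    (hP : SylowAt G S 2 P) : fixedPts P ⊆ B := by
  intro x hx
  by_contra hxB
  have h1 := h.orb_eq P hP x hxB
  have h2 : orb P x ⊆ {x} := orb_subset (fun g hg a ha => by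
    rw [Finset.mem_singleton] at *
    rw [ha, mem_fixedPts.1 hx g hg]) (Finset.mem_singleton_self x)
  have := Finset.card_le_card h2
  rw [h1, h.card_compl, Finset.card_singleton] at this
  omega

theorem unique {B' : Finset (Fin 24)} (h : IsOctad G S B) (h' : IsOctad G S B') : B = B' := by
  obtain ⟨P, hP⟩ := exists_sylowAt G S (p := 2) (by norm_num)
  have hle := Finset.card_union_le B B'
  rw [h.card, h'.card] at hle
  obtain ⟨x, hx⟩ : ((B ∪ B')ᶜ).Nonempty := by
    rw [← Finset.card_pos, Finset.card_compl, Fintype.card_fin]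
    omega
  rw [Finset.mem_compl, Finset.mem_union, not_or] at hx
  rw [← compl_inj_iff, ← h.orb_eq P hP x hx.1, h'.orb_eq P hP x hx.2]

end IsOctad

namespace FiveNotSix

variable {G : Subgroup (Perm (Fin 24))} (hG : FiveNotSix G)
include hG

theorem exists_isOctad {S : Finset (Fin 24)} (hS : S.card = 5) : ∃ B, IsOctad G S B := by
  obtain ⟨P, hP⟩ := exists_sylowAt G S (p := 2) (by norm_num)
  obtain ⟨-, -, -, -, w, -, hw⟩ := hG.exists_card_orb_eq hS hP
  obtain ⟨ho, hwS⟩ := hG.card_orb_eq_sixteen hS hP hw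
  refine ⟨(orb (pointFixer G S) w)ᶜ, hS, ?_, ?_, ?_, ?_⟩
  · rw [Finset.subset_compl_comm]
    exact orb_pointFixer_subset hwS
  · rw [ho, Finset.card_compl, hw, Fintype.card_fin]
  · intro g hg
    exact apply_mem_compl_of_invariant fun a ha => apply_mem_orb hg ha
  · intro Q hQ x hx
    obtain ⟨-, -, -, -, v, -, hv⟩ := hG.exists_card_orb_eq hS hQ
    obtain ⟨hov, hvS⟩ := hG.card_orb_eq_sixteen hS hQ hv
    rw [Finset.mem_compl, not_not] at hx
    rw [compl_compl]
    have hle := Finset.card_le_card (Finset.union_subset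
      (orb_pointFixer_subset (G := G) hwS) (orb_pointFixer_subset (G := G) hvS))
    have hui := Finset.card_union_add_card_inter (orb (pointFixer G S) w) (orb (pointFixer G S) v)
    rw [Finset.card_compl, hS, Fintype.card_fin] at hle
    have h1 : (orb (pointFixer G S) w).card = 16 := by rw [ho, hw]
    have h2 : (orb (pointFixer G S) v).card = 16 := by rw [hov, hv]
    obtain ⟨u, hu⟩ : (orb (pointFixer G S) w ∩ orb (pointFixer G S) v).Nonempty := by
      rw [← Finset.card_pos]
      omega
    rw [Finset.mem_inter] at hu
    have heq : orb (pointFixer G S) w = orb (pointFixer G S) v := by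
      rw [← orb_eq_of_mem hu.1, orb_eq_of_mem hu.2]
    rw [heq, hov] at hx ⊢
    exact orb_eq_of_mem hx

/-- A large subgroup of a Sylow 2-subgroup fixes the octad pointwise. -/
theorem exists_subgroup_fixing {S B : Finset (Fin 24)} (h : IsOctad G S B)
    {P : Subgroup (Perm (Fin 24))} (hP : SylowAt G S 2 P) :
    ∃ Q ≤ P, Nat.card P ≤ 2 * Nat.card Q ∧ B ⊆ fixedPts Q := by
  have hPB : ∀ g ∈ P, ∀ a ∈ B, g a ∈ B := fun g hg => h.apply_mem g (hP.le hg)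
  have hsub := h.fixedPts_subset hP
  have hdiff := Finset.card_sdiff_add_card_eq_card hsub
  rw [h.card] at hdiff
  rcases hG.card_fixedPts_two h.card_base hP with h6 | h8
  · obtain ⟨c, hc⟩ : (B \ fixedPts P).Nonempty := by
      rw [← Finset.card_pos]; omega
    refine ⟨pointFixer P {c}, pointFixer_le _ _, ?_, ?_⟩
    · rw [← card_orb_mul P c]
      refine Nat.mul_le_mul_right _ ?_
      have hle := Finset.card_le_card (orb_subset (A := B \ fixedPts P) (fun g hg a ha => by
        rw [Finset.mem_sdiff] at *
        exact ⟨hPB g hg a ha.1, fun h' => ha.2 (by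
          rwa [g.injective (mem_fixedPts.1 h' g hg)] at h')⟩) hc)
      omega
    · intro d hd
      rw [mem_fixedPts]
      intro g hg
      by_contra hne
      have hdF : d ∉ fixedPts P := fun hdF => hne (mem_fixedPts.1 hdF g hg.1)
      have hdc : d ≠ c := by
        rintro rfl
        exact hne (hg.2 d (Finset.mem_singleton_self d))
      have hpair : ({c, d} : Finset (Fin 24)) = B \ fixedPts P := by
        refine Finset.eq_of_subset_of_card_le ?_ ?_
        · intro e he
          rw [Finset.mem_insert, Finset.mem_singleton] at he
          rcases he with rfl | rfl
          · exact hc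
          · exact Finset.mem_sdiff.2 ⟨hd, hdF⟩
        · rw [Finset.card_pair hdc.symm]; omega
      have hgd : g d ∈ B \ fixedPts P := Finset.mem_sdiff.2 ⟨hPB g hg.1 d hd, fun h' =>
        hdF (by rwa [g.injective (mem_fixedPts.1 h' g hg.1)] at h')⟩
      rw [← hpair, Finset.mem_insert, Finset.mem_singleton] at hgd
      rcases hgd with h' | h'
      · rw [← hg.2 c (Finset.mem_singleton_self c)] at h'
        exact hdc (g.injective h')
      · exact hne h'
  · refine ⟨P, le_rfl, by omega, ?_⟩
    rw [Finset.eq_of_subset_of_card_le hsub (by rw [h.card, h8])]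

theorem isOctad_of_subset {S T B : Finset (Fin 24)} (h : IsOctad G S B) (hT : T.card = 5)
    (hTB : T ⊆ B) : IsOctad G T B := by
  obtain ⟨B', h'⟩ := hG.exists_isOctad hT
  suffices hs : B' ⊆ B by
    rwa [Finset.eq_of_subset_of_card_le hs (by rw [h.card, h'.card])] at h'
  intro b hb
  by_contra hbB
  obtain ⟨P, hP⟩ := exists_sylowAt G S (p := 2) (by norm_num)
  obtain ⟨Q, hQP, hcard, hQB⟩ := hG.exists_subgroup_fixing h hP
  have hQT : Q ≤ pointFixer G T := fun g hg =>
    ⟨hP.le_group (hQP hg), fun a ha => mem_fixedPts.1 (hQB (hTB ha)) g hg⟩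
  have hle := Finset.card_le_card (orb_subset (P := Q) (A := B' \ T) (fun g hg a ha => by
    rw [Finset.mem_sdiff] at *
    exact ⟨h'.apply_mem g (hQT hg) a ha.1, fun h1 => ha.2 (by
      rwa [g.injective ((hQT hg).2 _ h1)] at h1)⟩)
    (Finset.mem_sdiff.2 ⟨hb, fun h1 => hbB (hTB h1)⟩))
  have hdiff := Finset.card_sdiff_add_card_eq_card h'.subset
  rw [h'.card, hT] at hdiff
  have h1 := card_orb_mul Q b
  have h2 := card_orb_mul P b
  rw [h.orb_eq P hP b hbB, h.card_compl] at h2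
  have h3 : Nat.card (pointFixer Q {b}) ≤ Nat.card (pointFixer P {b}) :=
    Nat.le_of_dvd Nat.card_pos (Subgroup.card_dvd_of_le fun g hg => ⟨hQP hg.1, hg.2⟩)
  have hpos : 0 < Nat.card (pointFixer P {b}) := Nat.card_pos
  have h4 : (orb Q b).card * Nat.card (pointFixer Q {b}) ≤ 3 * Nat.card (pointFixer P {b}) :=
    Nat.mul_le_mul (by omega) h3
  omega

theorem isOctad_eq {S S' B B' : Finset (Fin 24)} (h : IsOctad G S B) (h' : IsOctad G S' B')
    (hc : 5 ≤ (B ∩ B').card) : B = B' := by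
  obtain ⟨T, hT, hT5⟩ := Finset.exists_subset_card_eq hc
  exact (hG.isOctad_of_subset h hT5 (hT.trans Finset.inter_subset_left)).unique
    (hG.isOctad_of_subset h' hT5 (hT.trans Finset.inter_subset_right))

theorem false_of_card_support_eq_twelve {t : Perm (Fin 24)} (ht : t ∈ G)
    (hp : IsPGroup 2 (zpowers t)) (hs : t.support.card = 12) : False := by
  have := Fact.mk Nat.prime_two
  obtain ⟨F, hF⟩ : ∃ F, F = t.supportᶜ := ⟨_, rfl⟩
  have hF12 : F.card = 12 := by rw [hF, Finset.card_compl, hs, Fintype.card_fin]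
  have hmF : ∀ {x}, x ∈ F ↔ t x = x := by intro x; rw [hF]; simp
  obtain ⟨A, hAF, hA3⟩ := Finset.exists_subset_card_eq (show 3 ≤ F.card by omega)
  have hU : (Finset.powersetCard 2 (F \ A)).card = 36 := by
    rw [Finset.card_powersetCard, Finset.card_sdiff_of_subset hAF, hF12, hA3]; rfl
  have hmem : ∀ {e}, e ∈ Finset.powersetCard 2 (F \ A) →
      (A ∪ e).card = 5 ∧ A ∪ e ⊆ F ∧ _root_.Disjoint A e ∧ e.card = 2 := by
    intro e he
    rw [Finset.mem_powersetCard] at he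
    have hd : _root_.Disjoint A e := by
      rw [Finset.disjoint_right]
      exact fun x hx => (Finset.mem_sdiff.1 (he.1 hx)).2
    exact ⟨by rw [Finset.card_union_of_disjoint hd, hA3, he.2],
      Finset.union_subset hAF (he.1.trans Finset.sdiff_subset), hd, he.2⟩
  have hex : ∀ e, ∃ B, e ∈ Finset.powersetCard 2 (F \ A) → IsOctad G (A ∪ e) B := by
    intro e
    by_cases he : e ∈ Finset.powersetCard 2 (F \ A)
    · obtain ⟨B, hB⟩ := hG.exists_isOctad (hmem he).1
      exact ⟨B, fun _ => hB⟩
    · exact ⟨∅, fun h => absurd h he⟩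
  choose oct hoct using hex
  have hinv : ∀ {e}, e ∈ Finset.powersetCard 2 (F \ A) → ∀ b ∈ oct e, t b ∈ oct e :=
    fun he => (hoct _ he).apply_mem t ⟨ht, fun a ha => hmF.1 ((hmem he).2.1 ha)⟩
  have hsub : ∀ {e B}, e ∈ Finset.powersetCard 2 (F \ A) → oct e ⊆ B → e ⊆ B \ A := by
    intro e B he hB x hx
    exact Finset.mem_sdiff.2 ⟨hB ((hoct e he).subset (Finset.mem_union_right _ hx)),
      Finset.disjoint_right.1 (hmem he).2.2.1 hx⟩
  have hAoct : ∀ {e}, e ∈ Finset.powersetCard 2 (F \ A) → A ⊆ oct e := fun he =>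
    Finset.subset_union_left.trans (hoct _ he).subset
  have hbad_eq : ∀ {e e'}, e ∈ Finset.powersetCard 2 (F \ A) →
      e' ∈ Finset.powersetCard 2 (F \ A) → oct e ⊆ F → oct e' ⊆ F → oct e = oct e' := by
    intro e e' he he' hF1 hF2
    by_contra hne
    have hi : (oct e ∩ oct e').card ≤ 4 := by
      by_contra hi
      exact hne (hG.isOctad_eq (hoct e he) (hoct e' he') (by omega))
    have hui := Finset.card_union_add_card_inter (oct e) (oct e')
    rw [(hoct e he).card, (hoct e' he').card] at hui
    have hun : oct e ∪ oct e' = F := Finset.eq_of_subset_of_card_le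
      (Finset.union_subset hF1 hF2) (by omega)
    obtain ⟨a, ha, ha'⟩ := Finset.exists_mem_notMem_of_card_lt_card
      (s := oct e ∩ oct e') (t := oct e) (by rw [(hoct e he).card]; omega)
    obtain ⟨b, hb, hb'⟩ := Finset.exists_mem_notMem_of_card_lt_card
      (s := oct e ∩ oct e') (t := oct e') (by rw [(hoct e' he').card]; omega)
    rw [Finset.mem_inter, not_and] at ha' hb'
    have hae' := ha' ha
    have hbe : b ∉ oct e := fun h => hb' h hb
    have hab : a ≠ b := by rintro rfl; exact hbe ha
    have hf : ({a, b} : Finset (Fin 24)) ∈ Finset.powersetCard 2 (F \ A) := by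
      rw [Finset.mem_powersetCard]
      refine ⟨fun x hx => ?_, Finset.card_pair hab⟩
      rw [Finset.mem_insert, Finset.mem_singleton] at hx
      rw [Finset.mem_sdiff]
      rcases hx with rfl | rfl
      · exact ⟨hF1 ha, fun h => hae' (hAoct he' h)⟩
      · exact ⟨hF2 hb, fun h => hbe (hAoct he h)⟩
    have haf : a ∈ oct {a, b} := (hoct _ hf).subset (by simp)
    have hbf : b ∈ oct {a, b} := (hoct _ hf).subset (by simp)
    have h1 : (oct {a, b} ∩ oct e).card ≤ 4 := by
      by_contra h
      rw [hG.isOctad_eq (hoct _ hf) (hoct e he) (by omega)] at hbf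
      exact hbe hbf
    have h2 : (oct {a, b} ∩ oct e').card ≤ 4 := by
      by_contra h
      rw [hG.isOctad_eq (hoct _ hf) (hoct e' he') (by omega)] at haf
      exact hae' haf
    have h3 := Finset.card_union_add_card_inter (oct {a, b} ∩ oct e) (oct {a, b} ∩ oct e')
    rw [← Finset.inter_union_distrib_left, hun] at h3
    have h4 : 3 ≤ (oct {a, b} ∩ oct e ∩ (oct {a, b} ∩ oct e')).card := by
      rw [← hA3]
      exact Finset.card_le_card (Finset.subset_inter (Finset.subset_inter (hAoct hf) (hAoct he))
        (Finset.subset_inter (hAoct hf) (hAoct he')))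
    have h5 : 5 ≤ (oct {a, b} ∩ F).card := by
      rw [← (hmem hf).1]
      exact Finset.card_le_card (Finset.subset_inter (hoct _ hf).subset (hmem hf).2.1)
    have h6 := card_modEq_inter_fixedPts hp (A := oct {a, b}) (fun g hg x hx =>
      zpow_mem_of_invariant (hinv hf) hg x hx)
    have h7 : fixedPts (zpowers t) = F := by
      ext x; rw [mem_fixedPts_zpowers, hmF]
    rw [h7, (hoct _ hf).card, Nat.ModEq] at h6
    omega
  have hbad : ((Finset.powersetCard 2 (F \ A)).filter fun e => oct e ⊆ F).card ≤ 10 := by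
    rcases Finset.eq_empty_or_nonempty
      ((Finset.powersetCard 2 (F \ A)).filter fun e => oct e ⊆ F) with h | ⟨e, he⟩
    · rw [h]; simp
    · rw [Finset.mem_filter] at he
      calc _ ≤ (Finset.powersetCard 2 (oct e \ A)).card := Finset.card_le_card fun f hf => by
            rw [Finset.mem_filter] at hf
            rw [Finset.mem_powersetCard]
            exact ⟨hsub hf.1 (hbad_eq hf.1 he.1 hf.2 he.2).subset, (hmem hf.1).2.2.2⟩
        _ = 10 := by
            rw [Finset.card_powersetCard, Finset.card_sdiff_of_subset (hAoct he.1),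
              (hoct e he.1).card, hA3]; rfl
  have hgood : ((Finset.powersetCard 2 (F \ A)).filter fun e => ¬ oct e ⊆ F).card * 2 ≤
      t.support.card * 3 := by
    refine Finset.card_mul_le_card_mul (fun e u => u ∈ oct e) ?_ ?_
    · intro e he
      rw [Finset.mem_filter, Finset.not_subset] at he
      obtain ⟨he, u, hu, huF⟩ := he
      rw [hmF] at huF
      rw [← Finset.card_pair (Ne.symm huF)]
      refine Finset.card_le_card fun x hx => ?_
      rw [Finset.mem_insert, Finset.mem_singleton] at hx
      rw [Finset.mem_bipartiteAbove, mem_support]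
      rcases hx with rfl | rfl
      · exact ⟨huF, hu⟩
      · exact ⟨fun h => huF (t.injective h), hinv he u hu⟩
    · intro u hu
      rw [mem_support] at hu
      rcases Finset.eq_empty_or_nonempty (Finset.bipartiteBelow (fun e u => u ∈ oct e)
        ((Finset.powersetCard 2 (F \ A)).filter fun e => ¬ oct e ⊆ F) u) with h | ⟨e, he⟩
      · rw [h]; simp
      rw [Finset.mem_bipartiteBelow, Finset.mem_filter] at he
      obtain ⟨⟨he, -⟩, hue⟩ := he
      have hT : ∀ {f}, f ∈ Finset.powersetCard 2 (F \ A) → u ∈ oct f →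
          A ∪ {u, t u} ⊆ oct f := fun hf huf =>
        Finset.union_subset (hAoct hf) (Finset.insert_subset huf
          (Finset.singleton_subset_iff.2 (hinv hf u huf)))
      have huA : _root_.Disjoint F {u, t u} := by
        rw [Finset.disjoint_right]
        intro x hx
        rw [Finset.mem_insert, Finset.mem_singleton] at hx
        rw [hmF]
        rcases hx with rfl | rfl
        · exact hu
        · exact fun h => hu (t.injective h)
      have hT5 : (A ∪ {u, t u}).card = 5 := by
        rw [Finset.card_union_of_disjoint (huA.mono_left hAF), hA3, Finset.card_pair (Ne.symm hu)]
      have h6 : (oct e ∩ F).card ≤ 6 := by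
        have h := Finset.card_le_card (Finset.union_subset
          (Finset.inter_subset_left (s₁ := oct e) (s₂ := F))
          (Finset.subset_union_right.trans (hT he hue)))
        rw [Finset.card_union_of_disjoint (huA.mono_left Finset.inter_subset_right),
          Finset.card_pair (Ne.symm hu), (hoct e he).card] at h
        omega
      calc _ ≤ (Finset.powersetCard 2 ((oct e ∩ F) \ A)).card :=
            Finset.card_le_card fun f hf => by
              rw [Finset.mem_bipartiteBelow, Finset.mem_filter] at hf
              have heq := hG.isOctad_eq (hoct f hf.1.1) (hoct e he) (by
                rw [← hT5]
                exact Finset.card_le_card (Finset.subset_inter (hT hf.1.1 hf.2) (hT he hue)))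
              have h1 := hsub hf.1.1 heq.subset
              rw [Finset.mem_powersetCard]
              refine ⟨fun x hx => ?_, (hmem hf.1.1).2.2.2⟩
              have h2 := Finset.mem_sdiff.1 (h1 hx)
              exact Finset.mem_sdiff.2 ⟨Finset.mem_inter.2 ⟨h2.1,
                (hmem hf.1.1).2.1 (Finset.mem_union_right _ hx)⟩, h2.2⟩
        _ ≤ Nat.choose 3 2 := by
            rw [Finset.card_powersetCard, Finset.card_sdiff_of_subset
              (Finset.subset_inter (hAoct he) hAF), hA3]
            exact Nat.choose_le_choose 2 (by omega)
        _ = 3 := rfl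
  have htot := Finset.card_filter_add_card_filter_not
    (s := Finset.powersetCard 2 (F \ A)) (fun e => oct e ⊆ F)
  omega

/-- A Sylow 2-subgroup of the pointwise stabilizer of `S` fixes the octad of `S` pointwise. -/
theorem fixedPts_eq {S B : Finset (Fin 24)} (h : IsOctad G S B)
    {P : Subgroup (Perm (Fin 24))} (hP : SylowAt G S 2 P) : fixedPts P = B := by
  have hsub := h.fixedPts_subset hP
  refine Finset.eq_of_subset_of_card_le hsub ?_
  rcases hG.card_fixedPts_two h.card_base hP with h6 | h8
  swap
  · rw [h.card, h8]
  exfalso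
  have := Fact.mk Nat.prime_two
  have := Fact.mk Nat.prime_five
  obtain ⟨z, hzG, hzP, hz, w, hw, hw16⟩ := hG.exists_card_orb_eq h.card_base hP
  have hwB : w ∉ B := by
    intro hwB
    have h1 := Finset.card_le_card (orb_subset (fun g hg => h.apply_mem g (hP.le hg)) hwB)
    rw [hw16, h.card] at h1
    omega
  have hBc : ∀ a ∈ Bᶜ, z a ∈ Bᶜ := by
    rw [← h.orb_eq P hP w hwB]
    exact apply_mem_orb_of_normalizer hzP hw
  have hB : ∀ a ∈ B, z a ∈ B := by
    have h1 := apply_mem_compl_of_invariant hBc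
    rwa [compl_compl] at h1
  have hF : ∀ a ∈ fixedPts P, z a ∈ fixedPts P := fun a ha => apply_mem_fixedPts hzP ha
  have hD : ∀ a ∈ B \ fixedPts P, z a ∈ B \ fixedPts P := fun a ha => by
    rw [Finset.mem_sdiff] at ha ⊢
    exact ⟨hB a ha.1, Finset.mem_compl.1
      (apply_mem_compl_of_invariant hF a (Finset.mem_compl.2 ha.2))⟩
  have hD2 : (B \ fixedPts P).card = 2 := by
    rw [Finset.card_sdiff_of_subset hsub, h.card, h6]
  have m1 := card_modEq_sdiff_support hz hD
  have m2 := card_modEq_sdiff_support hz hF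
  have m3 := card_modEq_sdiff_support hz hBc
  rw [h.card_compl, Nat.ModEq] at m3
  rw [h6, Nat.ModEq] at m2
  rw [hD2, Nat.ModEq] at m1
  have htot := hG.card_sdiff_support_add hzG hz B
  have hsplit : (B \ z.support).card = ((B \ fixedPts P) \ z.support).card +
      (fixedPts P \ z.support).card := by
    rw [← Finset.card_union_of_disjoint]
    · rw [← Finset.union_sdiff_distrib, Finset.sdiff_union_of_subset hsub]
    · exact Finset.disjoint_of_subset_left Finset.sdiff_subset
        (Finset.disjoint_of_subset_right Finset.sdiff_subset Finset.sdiff_disjoint)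
  have hDfix : B \ fixedPts P ⊆ z.supportᶜ := by
    have h1 : (B \ fixedPts P) \ z.support = B \ fixedPts P :=
      Finset.eq_of_subset_of_card_le Finset.sdiff_subset (by omega)
    intro x hx
    rw [← h1] at hx
    exact Finset.mem_compl.2 (Finset.mem_sdiff.1 hx).2
  have hone : (Bᶜ \ z.support).card = 1 := by omega
  obtain ⟨c, d, hcd, hpair⟩ := Finset.card_eq_two.1 hD2
  have hc : c ∈ B \ fixedPts P := by rw [hpair]; simp
  have hd : d ∈ B \ fixedPts P := by rw [hpair]; simp
  have hPD : ∀ g ∈ P, ∀ a ∈ B \ fixedPts P, g a ∈ B \ fixedPts P := fun g hg a ha => by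
    rw [Finset.mem_sdiff] at *
    exact ⟨h.apply_mem g (hP.le hg) a ha.1, fun h' => ha.2 (by
      rwa [g.injective (mem_fixedPts.1 h' g hg)] at h')⟩
  have hdc : d ∈ orb P c := by
    obtain ⟨g, hg, hgc⟩ : ∃ g ∈ P, g c ≠ c := by
      have := (Finset.mem_sdiff.1 hc).2
      rw [mem_fixedPts] at this
      push Not at this
      exact this
    have h1 := hPD g hg c hc
    rw [hpair, Finset.mem_insert, Finset.mem_singleton] at h1
    exact mem_orb.2 ⟨g, hg, h1.resolve_left hgc⟩
  obtain ⟨t, ht, htc, htz⟩ := exists_commute_apply_eq Nat.prime_two Nat.prime_five (by norm_num)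
    hP.pgroup hzP hz (by simpa using hDfix hc) (by simpa using hDfix hd) hdc
  have htG := hP.le_group ht
  have htd : t d = c := by
    have h1 := hPD t ht d hd
    rw [hpair, Finset.mem_insert, Finset.mem_singleton] at h1
    exact h1.resolve_right fun h => hcd (t.injective (htc.trans h.symm))
  have htB := h.apply_mem t (hP.le ht)
  have htBc : ∀ a ∈ Bᶜ, t a ∈ Bᶜ := apply_mem_compl_of_invariant htB
  have hsB : t.support ∩ B = {c, d} := by
    rw [← hpair]
    ext x
    rw [Finset.mem_inter, mem_support, Finset.mem_sdiff, and_comm]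
    refine and_congr_right fun hxB => ⟨fun hx hx' => hx (mem_fixedPts.1 hx' t ht), fun hx => ?_⟩
    have hxD : x ∈ B \ fixedPts P := Finset.mem_sdiff.2 ⟨hxB, hx⟩
    rw [hpair, Finset.mem_insert, Finset.mem_singleton] at hxD
    rcases hxD with rfl | rfl
    · rw [htc]; exact hcd.symm
    · rw [htd]; exact hcd
  have hwc : w ∈ Bᶜ \ z.support := by simp [hwB, hw]
  have htw : t w = w := by
    obtain ⟨v, hv⟩ := Finset.card_eq_one.1 hone
    have h1 : t w ∈ Bᶜ \ z.support := by
      rw [Finset.mem_sdiff]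
      refine ⟨htBc w (Finset.mem_compl.2 hwB), ?_⟩
      rw [notMem_support]
      have := DFunLike.congr_fun htz w
      rwa [mul_apply, mul_apply, hw] at this
    rw [hv, Finset.mem_singleton] at h1 hwc
    rw [h1, hwc]
  have hM5 : 5 ∣ (t.support \ B).card := by
    refine dvd_card_of_subset_support hz (fun a ha => ?_) (fun a ha => ?_)
    · rw [Finset.mem_sdiff, mem_support] at ha ⊢
      refine ⟨fun h' => ha.1 (z.injective ?_),
        Finset.mem_compl.1 (hBc a (Finset.mem_compl.2 ha.2))⟩
      have := DFunLike.congr_fun htz a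
      rw [mul_apply, mul_apply] at this
      rw [this, h']
    · rw [Finset.mem_sdiff] at ha
      by_contra haz
      obtain ⟨v, hv⟩ := Finset.card_eq_one.1 hone
      have h1 : a ∈ Bᶜ \ z.support := Finset.mem_sdiff.2 ⟨Finset.mem_compl.2 ha.2, haz⟩
      rw [hv, Finset.mem_singleton] at h1 hwc
      rw [mem_support, h1, ← hwc, htw] at ha
      exact ha.1 rfl
  have hp : IsPGroup 2 (zpowers t) := hP.pgroup.to_le (zpowers_le.2 ht)
  have hM2 : 2 ∣ (t.support \ B).card := by
    have h1 := card_modEq_inter_fixedPts hp (A := t.support \ B) fun g hg =>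
      zpow_mem_of_invariant (fun a ha => by
        rw [Finset.mem_sdiff] at ha ⊢
        exact ⟨by simpa using ha.1,
          Finset.mem_compl.1 (htBc a (Finset.mem_compl.2 ha.2))⟩) hg
    have h2 : (t.support \ B) ∩ fixedPts (zpowers t) = ∅ := by
      ext x; simp +contextual [mem_fixedPts_zpowers]
    rw [h2, Finset.card_empty] at h1
    exact Nat.modEq_zero_iff_dvd.1 h1
  have hlt : (t.support \ B).card < 16 := by
    rw [← h.card_compl]
    refine Finset.card_lt_card (Finset.ssubset_iff_of_subset ?_ |>.2 ⟨w, ?_, ?_⟩)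
    · intro x hx; exact Finset.mem_compl.2 (Finset.mem_sdiff.1 hx).2
    · exact Finset.mem_compl.2 hwB
    · simp [htw]
  have hcard : t.support.card = (t.support \ B).card + 2 := by
    rw [← Finset.card_pair hcd, ← hsB, Finset.card_sdiff_add_card_inter]
  obtain h0 | h10 : (t.support \ B).card = 0 ∨ (t.support \ B).card = 10 := by omega
  · have h2 : t.support.card = 2 := by omega
    refine hG.false_of_card_support_lt htG (q := 2) ?_ Nat.prime_two (by norm_num) (by omega)
    exact (card_support_eq_two.1 h2).orderOf
  · exact hG.false_of_card_support_eq_twelve htG hp (by omega)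

theorem subset_fixedPts_of_isPGroup {S B : Finset (Fin 24)} (h : IsOctad G S B)
    {Q : Subgroup (Perm (Fin 24))} (hQ : Q ≤ pointFixer G S) (hp : IsPGroup 2 Q) :
    B ⊆ fixedPts Q := by
  obtain ⟨P, hP⟩ := exists_sylowAt G S Nat.prime_two
  obtain ⟨k, hk, hkP⟩ := hP.conj Q hQ hp
  intro b hb
  rw [mem_fixedPts]
  intro q hq
  have h1 : k b ∈ fixedPts P := by
    rw [hG.fixedPts_eq h hP]
    exact h.apply_mem k hk b hb
  have h2 := mem_fixedPts.1 h1 _ (hkP q hq)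
  simpa using h2

/-- A Sylow 2-subgroup of the pointwise stabilizer of `S` acts freely off the octad of `S`. -/
theorem pointFixer_eq_bot {S B : Finset (Fin 24)} (h : IsOctad G S B)
    {P : Subgroup (Perm (Fin 24))} (hP : SylowAt G S 2 P) {x : Fin 24} (hx : x ∉ B) :
    pointFixer P {x} = ⊥ := by
  have hp : IsPGroup 2 (pointFixer P {x}) := hP.pgroup.to_le (pointFixer_le _ _)
  have hxF : x ∈ fixedPts (pointFixer P {x}) :=
    mem_fixedPts.2 fun g hg => hg.2 x (Finset.mem_singleton_self x)
  have hBF : B ⊆ fixedPts (pointFixer P {x}) := fun b hb => by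
    rw [← hG.fixedPts_eq h hP] at hb
    exact mem_fixedPts.2 fun g hg => mem_fixedPts.1 hb g hg.1
  have hclosed : ∀ T C, IsOctad G T C → T ⊆ fixedPts (pointFixer P {x}) →
      C ⊆ fixedPts (pointFixer P {x}) := fun T C hC hT =>
    hG.subset_fixedPts_of_isPGroup hC (fun g hg =>
      ⟨hP.le_group hg.1, fun a ha => mem_fixedPts.1 (hT ha) g hg⟩) hp
  obtain ⟨A, hAB, hA⟩ := Finset.exists_subset_card_eq (show 3 ≤ B.card by rw [h.card]; norm_num)
  have hxA : x ∉ A := fun hxA => hx (hAB hxA)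
  have hA4 : (insert x A).card = 4 := by rw [Finset.card_insert_of_notMem hxA, hA]
  have hex : ∀ l, ∃ C, l ∈ B \ A → IsOctad G (insert l (insert x A)) C := by
    intro l
    by_cases hl : l ∈ B \ A
    · rw [Finset.mem_sdiff] at hl
      have hlx : l ∉ insert x A := by
        rw [Finset.mem_insert, not_or]
        exact ⟨fun h => hx (h ▸ hl.1), hl.2⟩
      obtain ⟨C, hC⟩ := hG.exists_isOctad (S := insert l (insert x A))
        (by rw [Finset.card_insert_of_notMem hlx, hA4])
      exact ⟨C, fun _ => hC⟩
    · exact ⟨∅, fun h => absurd h hl⟩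
  choose oct hoct using hex
  have hsub : ∀ {l}, l ∈ B \ A → insert x A ⊆ oct l := fun hl =>
    (Finset.subset_insert _ _).trans (hoct _ hl).subset
  have hmem : ∀ {l}, l ∈ B \ A → l ∈ oct l := fun hl =>
    (hoct _ hl).subset (Finset.mem_insert_self _ _)
  have hU : ((B \ A).biUnion fun l => oct l \ insert x A).card = 20 := by
    rw [Finset.card_biUnion, Finset.sum_congr rfl (g := fun _ => 4) fun l hl => by
      rw [Finset.card_sdiff_of_subset (hsub hl), (hoct l hl).card, hA4]]
    · rw [Finset.sum_const, Finset.card_sdiff_of_subset hAB, h.card, hA]; rfl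
    · intro l hl m hm hlm
      rw [Finset.mem_coe] at hl hm
      refine Finset.disjoint_left.2 ?_
      intro y hy hy'
      rw [Finset.mem_sdiff] at hy hy'
      have heq : oct l = oct m := by
        refine hG.isOctad_eq (hoct l hl) (hoct m hm) ?_
        rw [show 5 = (insert y (insert x A)).card by
          rw [Finset.card_insert_of_notMem hy.2, hA4]]
        exact Finset.card_le_card (Finset.subset_inter
          (Finset.insert_subset hy.1 (hsub hl)) (Finset.insert_subset hy'.1 (hsub hm)))
      have hB : oct l = B := by
        refine hG.isOctad_eq (hoct l hl) h ?_
        have h5 : (insert l (insert m A)).card = 5 := by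
          rw [Finset.mem_sdiff] at hl hm
          rw [Finset.card_insert_of_notMem, Finset.card_insert_of_notMem hm.2, hA]
          rw [Finset.mem_insert, not_or]
          exact ⟨hlm, hl.2⟩
        rw [← h5]
        refine Finset.card_le_card (Finset.subset_inter (Finset.insert_subset (hmem hl)
          (Finset.insert_subset (heq ▸ hmem hm) ((Finset.subset_insert _ _).trans (hsub hl))))
          (Finset.insert_subset (Finset.mem_sdiff.1 hl).1
            (Finset.insert_subset (Finset.mem_sdiff.1 hm).1 hAB)))
      exact hx (hB ▸ hsub hl (Finset.mem_insert_self x A))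
  have hdisj : _root_.Disjoint ((B \ A).biUnion fun l => oct l \ insert x A) (insert x A) := by
    rw [Finset.disjoint_biUnion_left]
    exact fun l _ => Finset.sdiff_disjoint
  have hAF : insert x A ⊆ fixedPts (pointFixer P {x}) :=
    Finset.insert_subset hxF (hAB.trans hBF)
  have hle : ((B \ A).biUnion fun l => oct l \ insert x A) ∪ insert x A ⊆
      fixedPts (pointFixer P {x}) := by
    refine Finset.union_subset (Finset.biUnion_subset.2 fun l hl => ?_) hAF
    exact Finset.sdiff_subset.trans (hclosed _ _ (hoct l hl)
      (Finset.insert_subset (hBF (Finset.mem_sdiff.1 hl).1) hAF))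
  have h24 := Finset.card_le_card hle
  rw [Finset.card_union_of_disjoint hdisj, hU, hA4] at h24
  have huniv : fixedPts (pointFixer P {x}) = Finset.univ :=
    (Finset.card_eq_iff_eq_univ _).1 (le_antisymm (Finset.card_le_univ _) (by simpa using h24))
  rw [eq_bot_iff]
  intro g hg
  rw [mem_bot]
  ext a
  rw [mem_fixedPts.1 (huniv ▸ Finset.mem_univ a) g hg, one_apply]

theorem card_sylow {S : Finset (Fin 24)} (hS : S.card = 5)
    {P : Subgroup (Perm (Fin 24))} (hP : SylowAt G S 2 P) : Nat.card P = 16 := by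
  obtain ⟨B, h⟩ := hG.exists_isOctad hS
  obtain ⟨x, hx⟩ : (Bᶜ).Nonempty := by
    rw [← Finset.card_pos, h.card_compl]; norm_num
  rw [Finset.mem_compl] at hx
  rw [← card_orb_mul P x, h.orb_eq P hP x hx, h.card_compl, hG.pointFixer_eq_bot h hP hx,
    Subgroup.card_bot]

theorem card_pointFixer_dvd {S : Finset (Fin 24)} (hS : S.card = 5) :
    Nat.card (pointFixer G S) ∣ Nat.factorial 3 * Nat.factorial 16 := by
  obtain ⟨B, h⟩ := hG.exists_isOctad hS
  let H := pointFixer G S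
  let X : SubMulAction H (Fin 24) := ⟨↑(B \ S), fun c {x} hx => by
    rw [Finset.mem_coe, Finset.mem_sdiff] at hx ⊢
    exact ⟨h.apply_mem c.1 c.2 x hx.1, fun hxS => hx.2 (by
      have hxS' : c.1 x ∈ S := hxS
      rwa [c.1.injective (c.2.2 _ hxS')] at hxS')⟩⟩
  let Y : SubMulAction H (Fin 24) := ⟨↑(Bᶜ), fun c {x} hx =>
    apply_mem_compl_of_invariant (h.apply_mem c.1 c.2) x hx⟩
  have hX : Nat.card X = 3 := by
    have h1 : Nat.card X = (B \ S).card :=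
      (Nat.card_eq_card_toFinset (↑(B \ S) : Set (Fin 24))).trans (by simp)
    rw [h1, Finset.card_sdiff_of_subset h.subset, h.card, hS]
  have hY : Nat.card Y = 16 := by
    have h1 : Nat.card Y = (Bᶜ).card :=
      (Nat.card_eq_card_toFinset (↑(Bᶜ) : Set (Fin 24))).trans (by simp)
    rw [h1, h.card_compl]
  have hinj : Function.Injective ((toPermHom H X).prod (toPermHom H Y)) := by
    rw [injective_iff_map_eq_one]
    intro g hg
    rw [MonoidHom.prod_apply, Prod.mk_eq_one] at hg
    ext a
    rw [OneMemClass.coe_one, one_apply]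
    by_cases haS : a ∈ S
    · rw [g.2.2 a haS]
    by_cases haB : a ∈ B
    · have h1 := DFunLike.congr_fun hg.1 ⟨a, Finset.mem_coe.2 (Finset.mem_sdiff.2 ⟨haB, haS⟩)⟩
      exact congrArg (fun y : X => (y.1 : ℕ)) h1
    · have h1 := DFunLike.congr_fun hg.2 ⟨a, Finset.mem_coe.2 (Finset.mem_compl.2 haB)⟩
      exact congrArg (fun y : Y => (y.1 : ℕ)) h1
  have hd := Subgroup.card_dvd_of_injective _ hinj
  rwa [Nat.card_prod, Nat.card_perm, Nat.card_perm, hX, hY] at hd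

theorem card_pointFixer {S : Finset (Fin 24)} (hS : S.card = 5) :
    Nat.card (pointFixer G S) = 48 := by
  obtain ⟨P, hP⟩ := exists_sylowAt G S Nat.prime_two
  obtain ⟨m, hm, hmodd⟩ := hP.index
  rw [hG.card_sylow hS hP] at hm
  obtain ⟨a, -, b, hb, hab⟩ := hG.exists_card_eq hS
  have h4 : a = 4 := by
    have hd : 2 ^ 4 ∣ 2 ^ a := by
      refine Nat.Coprime.dvd_of_dvd_mul_right (n := 3 ^ b) ?_ ?_
      · exact Nat.Coprime.pow _ _ (by norm_num)
      · rw [← hab, hm]; exact Dvd.intro m rfl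
    have h1 : 4 ≤ a := (Nat.pow_dvd_pow_iff_le_right (by norm_num)).1 hd
    by_contra hne
    obtain ⟨c, rfl⟩ : ∃ c, a = 5 + c := ⟨a - 5, by omega⟩
    refine hmodd ⟨2 ^ c * 3 ^ b, ?_⟩
    have h2 : 16 * m = 16 * (2 * (2 ^ c * 3 ^ b)) := by rw [← hm, hab]; ring
    omega
  subst h4
  have hmod := hG.card_pointFixer_mod hS
  have hdvd := hG.card_pointFixer_dvd hS
  rw [hab] at hmod hdvd ⊢
  interval_cases b
  · revert hmod; decide
  · rfl
  all_goals first
    | (revert hmod; decide)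
    | (revert hdvd; norm_num [Nat.factorial])

end FiveNotSix

end Equiv.Perm

/-- the Mathieu group `M₂₄` (characterized as a 5-transitive but not
6-transitive subgroup of `S₂₄`) has order `2^10 · 3^3 · 5 · 7 · 11 · 23 = 244823040`. -/
theorem card_M24 (G : Subgroup (Equiv.Perm (Fin 24)))
    (h5 : IsKTransitive G 5) (h6 : ¬ IsKTransitive G 6) :
    Nat.card G = 2 ^ 10 * 3 ^ 3 * 5 * 7 * 11 * 23 ∧
      2 ^ 10 * 3 ^ 3 * 5 * 7 * 11 * 23 = 244823040 := by
  have hk : ∀ k, IsKTransitive G k ↔ Equiv.Perm.KTransOn G Finset.univ k := fun k =>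
    ⟨fun h x y _ _ => h x y, fun h x y => h x y (by simp) (by simp)⟩
  have hG : Equiv.Perm.FiveNotSix G := ⟨(hk 5).1 h5, fun h => h6 ((hk 6).2 h)⟩
  obtain ⟨S, -, hS⟩ := Finset.exists_subset_card_eq
    (show 5 ≤ (Finset.univ : Finset (Fin 24)).card by simp)
  refine ⟨?_, by norm_num⟩
  rw [hG.card_eq hS, hG.card_pointFixer hS]
  norm_num
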